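/- arXiv:2006.07884 — 2 statements merged into one kernel-verified Lean document; each statement's English description precedes it below -/
import Mathlib

section
/- Fix a real number a > -1/2, integers N ≥ 2 and 1 ≤ n ≤ N-1, and a parameter -1 < α < 2a+1. The dual Hahn polynomial W_n^{(α)} has n distinct real zeros X_1(α) < ⋯ < X_n(α) in (a(a+1), (a+N-1)(a+N)). If a ≥ 0, then for each j ∈ {1,...,n} the zero X_j(α) is a strictly increasing function of α on (-1, 2a+1). If -1/2 < a < 0, then each zero X_j(α) is a strictly increasing function of α on (a, 2a+1). -/
/-- Pochhammer symbol `(a)_k = ∏_{j=0}^{k-1} (a + j)`. -/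
noncomputable def poch (a : ℝ) (k : ℕ) : ℝ := ∏ j ∈ Finset.range k, (a + (j : ℝ))

/-- Dual Hahn polynomial `W_n^{(α)}(X)` in the variable `X` of the quadratic grid
`X = s(s+1)`. -/
noncomputable def dualHahnPoly (a : ℝ) (N n : ℕ) (α X : ℝ) : ℝ :=
  ∑ k ∈ Finset.range (n + 1),
    poch (-(n : ℝ)) k * (∏ j ∈ Finset.range k, ((a + (j : ℝ)) * (a + (j : ℝ) + 1) - X)) /
      (poch (α + 1) k * poch (1 - (N : ℝ)) k * (Nat.factorial k : ℝ))

open Polynomial in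
/-- A nonnegative weight that vanishes at no more than one node defines a positive definite form
on polynomials of small degree. -/
theorem sum_mul_eval_sq_pos {ι : Type*} {s : Finset ι} {t u : ι → ℝ} (ht : Set.InjOn t s)
    (i₀ : ι) (hu : ∀ i ∈ s, 0 ≤ u i) (hu' : ∀ i ∈ s, i ≠ i₀ → 0 < u i) {G : ℝ[X]}
    (hG : G ≠ 0) (hdeg : G.natDegree + 1 < s.card) :
    0 < ∑ i ∈ s, u i * (G.eval (t i)) ^ 2 := by
  classical
  refine Finset.sum_pos' (fun i hi => mul_nonneg (hu i hi) (sq_nonneg _)) ?_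
  by_contra! h
  refine hG (Polynomial.eq_zero_of_degree_lt_of_eval_index_eq_zero (s := s.erase i₀)
    (v := t) (ht.mono (Finset.coe_subset.2 (Finset.erase_subset i₀ s))) ?_ ?_)
  · rw [Polynomial.degree_eq_natDegree hG]
    have := Finset.pred_card_le_card_erase (s := s) (a := i₀)
    exact_mod_cast (by omega : G.natDegree < (s.erase i₀).card)
  · intro i hi
    obtain ⟨h1, h2⟩ := Finset.mem_erase.1 hi
    by_contra h3
    have := h i h2
    have := mul_pos (hu' i h2 h1) (pow_pos (abs_pos.2 h3) 2)
    rw [sq_abs] at this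
    linarith

/-- `P` is orthogonal to all polynomials of smaller degree with respect to the discrete measure
with masses `w i` at the nodes `t i`, `i ∈ s`. -/
def IsDiscreteOrthogonal {ι : Type*} (s : Finset ι) (t w : ι → ℝ) (P : Polynomial ℝ) : Prop :=
  ∀ q : Polynomial ℝ, q.natDegree < P.natDegree →
    ∑ i ∈ s, w i * (P.eval (t i) * q.eval (t i)) = 0

namespace IsDiscreteOrthogonal

open Polynomial

variable {ι : Type*} {s : Finset ι} {t w : ι → ℝ} {P : ℝ[X]}

/-- If `P = u * G` with `u` of positive degree, then `u` cannot be of one sign on the nodes. -/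
theorem not_sign_definite (hP : IsDiscreteOrthogonal s t w P) (ht : Set.InjOn t s)
    (hw : ∀ i ∈ s, 0 < w i) (hs : P.natDegree < s.card) (h0 : P ≠ 0) {u G : ℝ[X]}
    (hPu : P = u * G) (hu : 0 < u.natDegree) (i₀ : ι) (hu0 : ∀ i ∈ s, 0 ≤ u.eval (t i))
    (hu1 : ∀ i ∈ s, i ≠ i₀ → 0 < u.eval (t i)) : False := by
  have hu' : u ≠ 0 := by rintro rfl; simp at hu
  have hG : G ≠ 0 := by rintro rfl; simp at hPu; exact h0 hPu
  have hd : P.natDegree = u.natDegree + G.natDegree := by rw [hPu, natDegree_mul hu' hG]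
  have h := sum_mul_eval_sq_pos (u := fun i => w i * u.eval (t i)) ht i₀
    (fun i hi => mul_nonneg (hw i hi).le (hu0 i hi))
    (fun i hi h => mul_pos (hw i hi) (hu1 i hi h)) hG (by omega)
  have h2 := hP G (by omega)
  refine h.ne' (h2 ▸ Finset.sum_congr rfl fun i _ => ?_)
  rw [hPu, eval_mul]; ring

theorem not_sign_definite_neg (hP : IsDiscreteOrthogonal s t w P) (ht : Set.InjOn t s)
    (hw : ∀ i ∈ s, 0 < w i) (hs : P.natDegree < s.card) (h0 : P ≠ 0) {u G : ℝ[X]}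
    (hPu : P = u * G) (hu : 0 < u.natDegree) (i₀ : ι) (hu0 : ∀ i ∈ s, u.eval (t i) ≤ 0)
    (hu1 : ∀ i ∈ s, i ≠ i₀ → u.eval (t i) < 0) : False :=
  hP.not_sign_definite ht hw hs h0 (u := -u) (G := -G) (by rw [hPu]; ring) (by simpa using hu) i₀
    (fun i hi => by simpa using hu0 i hi) (fun i hi h => by simpa using hu1 i hi h)

theorem splits (hP : IsDiscreteOrthogonal s t w P) (ht : Set.InjOn t s)
    (hw : ∀ i ∈ s, 0 < w i) (hs : P.natDegree < s.card) (h0 : P ≠ 0) : P.Splits := by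
  have hne : s.Nonempty := Finset.card_pos.1 (by omega)
  obtain ⟨i₀, -⟩ := hne
  obtain ⟨g, hg, hcard, hroots⟩ := exists_prod_multiset_X_sub_C_mul P
  rw [splits_iff_card_roots]
  by_contra hdeg
  have hg_pos : 0 < g.natDegree := by omega
  have hg0 : g ≠ 0 := by rintro rfl; simp at hg_pos
  have hPg := hg.symm.trans (mul_comm _ _)
  have hg2 : ∀ x, g.eval x ≠ 0 := fun x hx => by
    have : x ∈ g.roots := (mem_roots hg0).2 hx
    simp [hroots] at this
  rcases lt_or_gt_of_ne (hg2 0) with h | h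
  · have hneg : ∀ x, g.eval x < 0 := by
      intro x
      by_contra! hx
      obtain ⟨y, hy⟩ := mem_range_of_exists_le_of_exists_ge g.continuous ⟨0, h.le⟩ ⟨x, hx⟩
      exact hg2 y hy
    exact hP.not_sign_definite_neg ht hw hs h0 hPg hg_pos i₀ (fun i _ => (hneg _).le)
      (fun i _ _ => hneg _)
  · have hpos : ∀ x, 0 < g.eval x := by
      intro x
      by_contra! hx
      obtain ⟨y, hy⟩ := mem_range_of_exists_le_of_exists_ge g.continuous ⟨x, hx⟩ ⟨0, h.le⟩
      exact hg2 y hy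
    exact hP.not_sign_definite ht hw hs h0 hPg hg_pos i₀ (fun i _ => (hpos _).le)
      (fun i _ _ => hpos _)

theorem nodup_roots (hP : IsDiscreteOrthogonal s t w P) (ht : Set.InjOn t s)
    (hw : ∀ i ∈ s, 0 < w i) (hs : P.natDegree < s.card) (h0 : P ≠ 0) : P.roots.Nodup := by
  have hne : s.Nonempty := Finset.card_pos.1 (by omega)
  obtain ⟨i₁, -⟩ := hne
  rw [Multiset.nodup_iff_count_le_one]
  intro c
  by_contra! hc
  rw [count_roots] at hc
  obtain ⟨G, hG⟩ := (le_rootMultiplicity_iff h0).1 hc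
  have key : ∀ i₀, (∀ i ∈ s, i ≠ i₀ → t i ≠ c) → False := fun i₀ h =>
    hP.not_sign_definite ht hw hs h0 hG (by simp [natDegree_pow]) i₀
      (fun i _ => by simp; positivity)
      (fun i hi hi0 => by have := sub_ne_zero.2 (h i hi hi0); simp; positivity)
  by_cases h : ∃ i₀ ∈ s, t i₀ = c
  · obtain ⟨i₀, h1, h2⟩ := h
    exact key i₀ fun i hi hne h3 => hne (ht hi h1 (h3.trans h2.symm))
  · push Not at h
    exact key i₁ fun i hi _ => h i hi

theorem lt_root (hP : IsDiscreteOrthogonal s t w P) (ht : Set.InjOn t s)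
    (hw : ∀ i ∈ s, 0 < w i) (hs : P.natDegree < s.card) (h0 : P ≠ 0) {c : ℝ} (hc : P.IsRoot c)
    {i₀ : ι} (hi₀ : ∀ i ∈ s, i ≠ i₀ → t i₀ < t i) : t i₀ < c := by
  by_contra! h
  obtain ⟨G, hG⟩ := dvd_iff_isRoot.2 hc
  refine hP.not_sign_definite ht hw hs h0 hG (by simp) i₀ (fun i hi => ?_) fun i hi hne => ?_
  · rcases eq_or_ne i i₀ with rfl | hne
    · simpa using h
    · simpa using h.trans (hi₀ i hi hne).le
  · simpa using h.trans_lt (hi₀ i hi hne)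

theorem root_lt (hP : IsDiscreteOrthogonal s t w P) (ht : Set.InjOn t s)
    (hw : ∀ i ∈ s, 0 < w i) (hs : P.natDegree < s.card) (h0 : P ≠ 0) {c : ℝ} (hc : P.IsRoot c)
    {i₀ : ι} (hi₀ : ∀ i ∈ s, i ≠ i₀ → t i < t i₀) : c < t i₀ := by
  by_contra! h
  obtain ⟨G, hG⟩ := dvd_iff_isRoot.2 hc
  refine hP.not_sign_definite_neg ht hw hs h0 hG (by simp) i₀ (fun i hi => ?_) fun i hi hne => ?_
  · rcases eq_or_ne i i₀ with rfl | hne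
    · simpa using h
    · simpa using (hi₀ i hi hne).le.trans h
  · simpa using (hi₀ i hi hne).trans_le h

theorem exists_roots (hP : IsDiscreteOrthogonal s t w P) (ht : Set.InjOn t s)
    (hw : ∀ i ∈ s, 0 < w i) (hs : P.natDegree < s.card) (h0 : P ≠ 0) {n : ℕ}
    (hn : P.natDegree = n) :
    ∃ x : Fin n → ℝ, StrictMono x ∧ (∀ j, P.IsRoot (x j)) ∧ ∀ y, P.IsRoot y → ∃ j, y = x j := by
  classical
  have hcard : P.roots.toFinset.card = n := by
    rw [Multiset.toFinset_card_of_nodup (hP.nodup_roots ht hw hs h0), ← hn,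
      (hP.splits ht hw hs h0).natDegree_eq_card_roots]
  refine ⟨P.roots.toFinset.orderEmbOfFin hcard, OrderEmbedding.strictMono _, fun j => ?_,
    fun y hy => ?_⟩
  · exact isRoot_of_mem_roots (Multiset.mem_toFinset.1 (Finset.orderEmbOfFin_mem _ hcard j))
  · have : y ∈ Set.range (P.roots.toFinset.orderEmbOfFin hcard) := by
      rw [Finset.range_orderEmbOfFin]; simpa [h0] using hy
    obtain ⟨j, hj⟩ := this
    exact ⟨j, hj.symm⟩

/-- Gauss quadrature at the zeros of an orthogonal polynomial. -/
theorem gauss_quadrature (hP : IsDiscreteOrthogonal s t w P) {n : ℕ} (hn : P.natDegree = n)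
    (hn1 : 1 ≤ n) {x : Fin n → ℝ} (hx : Function.Injective x) (hroot : ∀ j, P.IsRoot (x j))
    {F : ℝ[X]} (hF : F.natDegree < 2 * n) :
    ∑ i ∈ s, w i * F.eval (t i) = ∑ j, F.eval (x j) *
      ∑ i ∈ s, w i * (Lagrange.basis Finset.univ x j).eval (t i) := by
  have h0 : P ≠ 0 := by rintro rfl; simp at hn; omega
  have hdiv : (F / P).natDegree < P.natDegree := by
    rcases lt_or_ge F.degree P.degree with h | h
    · rw [(Polynomial.div_eq_zero_iff h0).2 h]; simp; omega
    · have hFP : F / P ≠ 0 := fun h' => absurd ((Polynomial.div_eq_zero_iff h0).1 h') (not_lt.2 h)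
      have h2 := congrArg natDegree (EuclideanDomain.div_add_mod F P)
      have h1 := degree_add_div h0 h
      have hF0 : F ≠ 0 := by rintro rfl; simp at hFP
      rw [degree_eq_natDegree h0, degree_eq_natDegree hFP, degree_eq_natDegree hF0] at h1
      have h3 : P.natDegree + (F / P).natDegree = F.natDegree := by exact_mod_cast h1
      omega
  have hev : ∀ y, F.eval y = P.eval y * (F / P).eval y + (F % P).eval y := fun y => by
    conv_lhs => rw [← EuclideanDomain.div_add_mod F P]
    simp
  have hmod : F % P = Lagrange.interpolate Finset.univ x (fun j => F.eval (x j)) := by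
    refine Lagrange.eq_interpolate_of_eval_eq _ hx.injOn ?_ fun j _ => ?_
    · have := EuclideanDomain.mod_lt F h0
      rw [Finset.card_univ, Fintype.card_fin, ← hn, ← degree_eq_natDegree h0]
      exact this
    · rw [hev (x j), (hroot j).eq_zero]; ring
  have h1 : ∑ i ∈ s, w i * F.eval (t i) = ∑ i ∈ s, w i * (F % P).eval (t i) := by
    rw [← add_zero (∑ i ∈ s, w i * (F % P).eval (t i)), ← hP (F / P) hdiv,
      ← Finset.sum_add_distrib]
    refine Finset.sum_congr rfl fun i _ => ?_
    rw [hev (t i)]; ring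
  rw [h1, hmod]
  simp only [Lagrange.interpolate_apply, eval_finsetSum, eval_mul, eval_C, Finset.mul_sum]
  rw [Finset.sum_comm]
  exact Finset.sum_congr rfl fun j _ => Finset.sum_congr rfl fun i _ => by ring

/-- The weights of Gauss quadrature are nonnegative. -/
theorem sum_mul_eval_nonneg (hP : IsDiscreteOrthogonal s t w P) (hw : ∀ i ∈ s, 0 < w i) {n : ℕ}
    (hn : P.natDegree = n) (hn1 : 1 ≤ n) {x : Fin n → ℝ} (hx : Function.Injective x)
    (hroot : ∀ j, P.IsRoot (x j)) {F : ℝ[X]} (hF : F.natDegree < 2 * n)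
    (hpos : ∀ j, 0 ≤ F.eval (x j)) : 0 ≤ ∑ i ∈ s, w i * F.eval (t i) := by
  rw [hP.gauss_quadrature hn hn1 hx hroot hF]
  refine Finset.sum_nonneg fun j _ => mul_nonneg (hpos j) ?_
  have hd := Lagrange.natDegree_basis (s := Finset.univ) (v := x) hx.injOn (Finset.mem_univ j)
  have h := hP.gauss_quadrature hn hn1 hx hroot (F := Lagrange.basis Finset.univ x j ^ 2)
    (by rw [natDegree_pow, hd, Finset.card_univ, Fintype.card_fin]; omega)
  rw [Finset.sum_eq_single j] at h
  · rw [eval_pow, Lagrange.eval_basis_self hx.injOn (Finset.mem_univ j), one_pow, one_mul] at h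
    rw [← h]
    exact Finset.sum_nonneg fun i hi => mul_nonneg (hw i hi).le (by rw [eval_pow]; positivity)
  · intro k _ hk
    rw [eval_pow, Lagrange.eval_basis_of_ne hk.symm (Finset.mem_univ k)]; simp
  · simp

/-- Discrete Markov theorem: if the ratio of two weights increases strictly along the nodes, then
so do the zeros of the corresponding orthogonal polynomials. -/
theorem root_lt_root {M : ℕ} {t w r : ℕ → ℝ} (ht : StrictMono t) (hr : StrictMono r)
    (hw : ∀ i ∈ Finset.range (M + 1), 0 < w i) (hr0 : ∀ i, 0 < r i) {P Q : ℝ[X]}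
    (hP : IsDiscreteOrthogonal (Finset.range (M + 1)) t w P)
    (hQ : IsDiscreteOrthogonal (Finset.range (M + 1)) t (fun i => r i * w i) Q)
    {n : ℕ} (hnM : n ≤ M) (hPn : P.natDegree = n) (hQn : Q.natDegree = n)
    {x y : Fin n → ℝ} (hx : StrictMono x) (hy : StrictMono y)
    (hPx : ∀ j, P.IsRoot (x j)) (hQy : ∀ j, Q.IsRoot (y j)) (k : Fin n) : x k < y k := by
  by_contra! hle
  have hn1 : 1 ≤ n := by have := k.2; omega
  have h0 : P ≠ 0 := by rintro rfl; simp at hPn; omega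
  have hlow : t 0 < x k := by
    refine hP.lt_root ht.injective.injOn hw (by simp; omega) h0 (hPx k) fun i _ hi => ht (by omega)
  obtain ⟨i₀, hi₀, hlt, hge⟩ : ∃ i₀ : ℕ, t i₀ ≤ x k ∧ (∀ i < i₀, t i < x k) ∧
      ∀ i ∈ Finset.range (M + 1), i₀ < i → x k < t i := by
    classical
    refine ⟨Nat.findGreatest (fun i => t i ≤ x k) M, ?_, ?_, ?_⟩
    · exact Nat.findGreatest_spec (P := fun i => t i ≤ x k) (Nat.zero_le M) hlow.le
    · intro i hi
      exact (ht hi).trans_le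
        (Nat.findGreatest_spec (P := fun i => t i ≤ x k) (Nat.zero_le M) hlow.le)
    · intro i hi h
      exact not_le.1 (Nat.findGreatest_is_greatest h (by simp at hi; omega))
  set G : ℝ[X] := (∏ j ∈ Finset.Iio k, (X - C (x j))) * ∏ j ∈ Finset.Ioi k, (X - C (y j)) with hGdef
  have hGmonic : G.Monic := (monic_prod_of_monic _ _ fun j _ => monic_X_sub_C _).mul
    (monic_prod_of_monic _ _ fun j _ => monic_X_sub_C _)
  have hGdeg : G.natDegree = n - 1 := by
    rw [hGdef, (monic_prod_of_monic _ _ fun j _ => monic_X_sub_C _).natDegree_mul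
      (monic_prod_of_monic _ _ fun j _ => monic_X_sub_C _), natDegree_prod_of_monic _ _
      fun j _ => monic_X_sub_C _, natDegree_prod_of_monic _ _ fun j _ => monic_X_sub_C _]
    simp
    omega
  have hGx : ∀ j < k, G.eval (x j) = 0 := fun j hj => by
    rw [hGdef, eval_mul, eval_prod, Finset.prod_eq_zero (Finset.mem_Iio.2 hj) (by simp), zero_mul]
  have hGy : ∀ j, k < j → G.eval (y j) = 0 := fun j hj => by
    rw [hGdef, eval_mul, eval_prod _ _ (y j), eval_prod,
      Finset.prod_eq_zero (Finset.mem_Ioi.2 hj) (by simp), mul_zero]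
  have hFdeg : ((X - C (x k)) * G ^ 2).natDegree < 2 * n := by
    rw [(monic_X_sub_C _).natDegree_mul (hGmonic.pow 2), natDegree_pow, hGdeg, natDegree_X_sub_C]
    omega
  have h1 := hP.sum_mul_eval_nonneg hw hPn hn1 hx.injective hPx hFdeg fun j => by
    rcases lt_or_ge j k with h | h
    · simp [hGx j h]
    · have := hx.monotone h
      simp only [eval_mul, eval_sub, eval_X, eval_C, eval_pow]
      exact mul_nonneg (by linarith) (sq_nonneg _)
  have h2 := hQ.sum_mul_eval_nonneg (fun i hi => mul_pos (hr0 i) (hw i hi)) hQn hn1 hy.injective hQy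
    (F := -((X - C (x k)) * G ^ 2)) (by rwa [natDegree_neg]) fun j => by
    rcases lt_or_ge k j with h | h
    · simp [hGy j h]
    · have := hy.monotone h
      simp only [eval_mul, eval_sub, eval_X, eval_C, eval_pow, eval_neg]
      rw [← neg_mul]
      exact mul_nonneg (by linarith) (sq_nonneg _)
  have h3 := sum_mul_eval_sq_pos (s := Finset.range (M + 1)) (t := t)
    (u := fun i => w i * ((r i - r i₀) * (t i - x k))) ht.injective.injOn i₀ ?_ ?_
    hGmonic.ne_zero (by simp; omega)
  · have h4 : ∑ i ∈ Finset.range (M + 1),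
        w i * ((r i - r i₀) * (t i - x k)) * G.eval (t i) ^ 2 =
        -(∑ i ∈ Finset.range (M + 1), r i * w i * (-((X - C (x k)) * G ^ 2)).eval (t i)) -
        r i₀ * ∑ i ∈ Finset.range (M + 1), w i * ((X - C (x k)) * G ^ 2).eval (t i) := by
      rw [Finset.mul_sum, ← Finset.sum_neg_distrib, ← Finset.sum_sub_distrib]
      refine Finset.sum_congr rfl fun i _ => ?_
      simp only [eval_mul, eval_sub, eval_X, eval_C, eval_pow, eval_neg]
      ring
    have := mul_nonneg (hr0 i₀).le h1
    linarith
  · intro i hi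
    refine mul_nonneg (hw i hi).le ?_
    rcases lt_trichotomy i i₀ with h | rfl | h
    · exact mul_nonneg_of_nonpos_of_nonpos (sub_nonpos.2 (hr h).le) (sub_nonpos.2 (hlt i h).le)
    · simp
    · exact mul_nonneg (sub_nonneg.2 (hr h).le) (sub_nonneg.2 (hge i hi h).le)
  · intro i hi hne
    refine mul_pos (hw i hi) ?_
    rcases lt_or_gt_of_ne hne with h | h
    · exact mul_pos_of_neg_of_neg (sub_neg.2 (hr h)) (sub_neg.2 (hlt i h))
    · exact mul_pos (sub_pos.2 (hr h)) (sub_pos.2 (hge i hi h))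

end IsDiscreteOrthogonal

open Polynomial in
theorem LinearMap.eq_zero_of_natDegree_lt_of_monic (L : ℝ[X] →ₗ[ℝ] ℝ) {n : ℕ} {ψ : ℕ → ℝ[X]}
    (hψ : ∀ m, (ψ m).Monic) (hdeg : ∀ m, (ψ m).natDegree = m) (hL : ∀ m < n, L (ψ m) = 0)
    {q : ℝ[X]} (hq : q.natDegree < n) : L q = 0 := by
  have key : ∀ d ≤ n, ∀ q : ℝ[X], q.degree < d → L q = 0 := by
    intro d
    induction d with
    | zero =>
      intro _ q hq
      rw [Nat.cast_zero, ← not_le, zero_le_degree_iff, not_not] at hq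
      simp [hq]
    | succ d ih =>
      intro hd q hq
      have h : L (q - q.coeff d • ψ d) = 0 := by
        refine ih (by omega) _ ((degree_lt_iff_coeff_zero _ _).2 fun m hm => ?_)
        rcases hm.eq_or_lt with rfl | hm
        · have := (hψ d).coeff_natDegree
          rw [hdeg] at this
          simp [this]
        · rw [coeff_sub, coeff_smul, (degree_lt_iff_coeff_zero _ _).1 hq m hm,
            coeff_eq_zero_of_natDegree_lt ((hdeg d).trans_lt hm)]
          simp
      rw [map_sub, map_smul, hL d (by omega)] at h
      simpa using h
  exact key n le_rfl q (degree_le_natDegree.trans_lt (by exact_mod_cast hq))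

theorem poch_pos {a : ℝ} (ha : 0 < a) (k : ℕ) : 0 < poch a k :=
  Finset.prod_pos fun _ _ => by positivity

theorem poch_succ (a : ℝ) (k : ℕ) : poch a (k + 1) = poch a k * (a + k) :=
  Finset.prod_range_succ _ _

/-- Pochhammer symbols at nonpositive integers are signed falling factorials. -/
theorem poch_neg_natCast (n k : ℕ) : poch (-(n : ℝ)) k = (-1) ^ k * (n.descFactorial k : ℝ) := by
  induction k with
  | zero => simp [poch]
  | succ k ih =>
    rw [poch_succ, ih, Nat.descFactorial_succ]
    rcases le_or_gt k n with h | h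
    · push_cast [h]; ring
    · rw [Nat.descFactorial_of_lt h]; simp

namespace Lagrange

/-- Divided differences of a multiple of the nodal polynomial of some of the nodes. -/
theorem sum_nodalWeight_mul_prod_sdiff {ι : Type*} [DecidableEq ι] {t : ι → ℝ}
    {s T : Finset ι} (ht : Set.InjOn t T) (hs : s ⊆ T) (f : ι → ℝ) :
    ∑ x ∈ T, nodalWeight T t x * ((∏ j ∈ T \ s, (t x - t j)) * f x) =
      ∑ x ∈ s, nodalWeight s t x * f x := by
  rw [← Finset.sum_subset hs]
  · refine Finset.sum_congr rfl fun x hx => ?_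
    have h : T.erase x = (T \ s) ∪ s.erase x := by
      ext j; simp only [Finset.mem_erase, Finset.mem_union, Finset.mem_sdiff]
      have := @hs j
      by_cases h1 : j ∈ s
      · simp [h1, this h1]
      · have h2 : j ≠ x := fun h => h1 (h ▸ hx)
        simp [h1, h2]
    have hdisj : Disjoint (T \ s) (s.erase x) :=
      Finset.sdiff_disjoint.mono_right (Finset.erase_subset _ _)
    have hne : ∏ j ∈ T \ s, (t x - t j) ≠ 0 := Finset.prod_ne_zero_iff.2 fun j hj => by
      rw [Finset.mem_sdiff] at hj
      exact sub_ne_zero.2 fun h => hj.2 (ht (hs hx) hj.1 h ▸ hx)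
    rw [nodalWeight, h, Finset.prod_union hdisj, Finset.prod_inv_distrib, ← nodalWeight]
    field_simp
  · intro x hx hxs
    rw [Finset.prod_eq_zero (Finset.mem_sdiff.2 ⟨hx, hxs⟩) (sub_self _)]
    simp

/-- The recursion for divided differences. -/
theorem sub_mul_sum_nodalWeight_Ico {t : ℕ → ℝ} (ht : Function.Injective t) (f : ℕ → ℝ)
    {k m : ℕ} (hkm : k < m) :
    (t m - t k) * ∑ x ∈ Finset.Ico k (m + 1), nodalWeight (Finset.Ico k (m + 1)) t x * f x =
      ∑ x ∈ Finset.Ico (k + 1) (m + 1), nodalWeight (Finset.Ico (k + 1) (m + 1)) t x * f x -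
      ∑ x ∈ Finset.Ico k m, nodalWeight (Finset.Ico k m) t x * f x := by
  have h1 : Finset.Ico k (m + 1) \ Finset.Ico (k + 1) (m + 1) = {k} := by
    ext; simp; omega
  have h2 : Finset.Ico k (m + 1) \ Finset.Ico k m = {m} := by
    ext; simp; omega
  rw [← sum_nodalWeight_mul_prod_sdiff (T := Finset.Ico k (m + 1)) ht.injOn
      (Finset.Ico_subset_Ico_left (Nat.le_succ k)) f,
    ← sum_nodalWeight_mul_prod_sdiff (T := Finset.Ico k (m + 1)) (s := Finset.Ico k m) ht.injOn
      (Finset.Ico_subset_Ico_right (Nat.le_succ m)) f, h1, h2, Finset.mul_sum,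
    ← Finset.sum_sub_distrib]
  refine Finset.sum_congr rfl fun x _ => ?_
  simp only [Finset.prod_singleton]
  ring

theorem abs_nodalWeight_range {t : ℕ → ℝ} (ht : StrictMono t) {M x : ℕ} (hx : x ≤ M) :
    |nodalWeight (Finset.range (M + 1)) t x| =
      (-1) ^ (M + x) * nodalWeight (Finset.range (M + 1)) t x := by
  have h : (Finset.range (M + 1)).erase x = Finset.range x ∪ Finset.Ico (x + 1) (M + 1) := by
    ext; simp; omega
  have hdisj : Disjoint (Finset.range x) (Finset.Ico (x + 1) (M + 1)) := by
    rw [Finset.disjoint_left]; intro j; simp; omega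
  rw [nodalWeight, h, Finset.prod_union hdisj, abs_mul, Finset.abs_prod, Finset.abs_prod,
    Finset.prod_congr rfl (fun j hj => abs_of_pos (inv_pos.2 (sub_pos.2
      (ht (Finset.mem_range.1 hj))))),
    Finset.prod_congr (s₁ := Finset.Ico (x + 1) (M + 1)) rfl (fun j hj => abs_of_neg
      (inv_lt_zero.2 (sub_neg.2 (ht (Nat.lt_of_succ_le (Finset.mem_Ico.1 hj).1))))),
    Finset.prod_neg, Nat.card_Ico]
  have : (-1 : ℝ) ^ (M + x) = (-1) ^ (M + 1 - (x + 1)) := by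
    rw [show M + x = (M + 1 - (x + 1)) + 2 * x by omega, pow_add, pow_mul]; simp
  rw [this]; ring

end Lagrange

/-- The `n`-th finite difference of a polynomial of degree less than `n` vanishes. -/
theorem sum_neg_one_pow_mul_choose_mul_eval {p : Polynomial ℝ} {n : ℕ} (hp : p.natDegree < n) :
    ∑ k ∈ Finset.range (n + 1), (-1 : ℝ) ^ k * (n.choose k : ℝ) * p.eval (k : ℝ) = 0 := by
  have h := congrFun (Polynomial.fwdDiff_iter_eq_zero_of_degree_lt hp) 0
  rw [fwdDiff_iter_eq_sum_shift] at h
  have h2 := congrArg (fun z => (-1 : ℝ) ^ n * z) h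
  simp only [Pi.zero_apply, mul_zero, Finset.mul_sum] at h2
  rw [← h2]
  refine Finset.sum_congr rfl fun k hk => ?_
  have hk : k ≤ n := Nat.lt_succ_iff.1 (Finset.mem_range.1 hk)
  have : (-1 : ℝ) ^ n * (-1) ^ (n - k) = (-1) ^ k := by
    rw [← pow_add, show n + (n - k) = k + 2 * (n - k) by omega, pow_add, pow_mul]; simp
  simp only [zsmul_eq_mul, nsmul_eq_mul, mul_one, zero_add]
  push_cast
  rw [← this]; ring

/-- The quadratic grid on which the dual Hahn polynomials are orthogonal. -/
noncomputable def dualHahnGrid (a : ℝ) (j : ℕ) : ℝ := (a + (j : ℝ)) * (a + (j : ℝ) + 1)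

theorem dualHahnGrid_strictMono {a : ℝ} (ha : -1 / 2 < a) : StrictMono (dualHahnGrid a) := by
  refine strictMono_nat_of_lt_succ fun j => ?_
  have : (0 : ℝ) ≤ j := j.cast_nonneg
  simp only [dualHahnGrid]
  push_cast
  nlinarith

/-- The part of the dual Hahn weight that depends on `α`. -/
noncomputable def dualHahnRatio (a α : ℝ) (x : ℕ) : ℝ :=
  poch (α + 1) x / poch (2 * a - α + 1) x

theorem dualHahnRatio_pos {a α : ℝ} (h1 : -1 < α) (h2 : α < 2 * a + 1) (x : ℕ) :
    0 < dualHahnRatio a α x :=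
  div_pos (poch_pos (by linarith) x) (poch_pos (by linarith) x)

theorem dualHahnRatio_succ (a α : ℝ) (x : ℕ) : dualHahnRatio a α (x + 1) =
    dualHahnRatio a α x * ((α + 1 + x) / (2 * a - α + 1 + x)) := by
  rw [dualHahnRatio, dualHahnRatio, poch_succ, poch_succ, mul_div_mul_comm]

theorem dualHahnRatio_div_strictMono {a α β : ℝ} (h1 : -1 < α) (h : α < β)
    (h2 : β < 2 * a + 1) :
    StrictMono fun x => dualHahnRatio a β x / dualHahnRatio a α x := by
  refine strictMono_nat_of_lt_succ fun x => ?_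
  have hx : (0 : ℝ) ≤ x := x.cast_nonneg
  have hα := dualHahnRatio_pos h1 (h.trans h2) x
  have hβ := dualHahnRatio_pos (h1.trans h) h2 x
  have p1 : 0 < α + 1 + x := by linarith
  have p2 : 0 < 2 * a - β + 1 + x := by linarith
  have p3 : 0 < 2 * a - α + 1 + x := by linarith
  rw [dualHahnRatio_succ, dualHahnRatio_succ, mul_div_mul_comm]
  refine lt_mul_of_one_lt_right (div_pos hβ hα) ?_
  rw [one_lt_div (div_pos p1 p3), div_lt_div_iff₀ p3 p2]
  nlinarith

/-- Divided differences of the signed ratio function. -/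
theorem sum_nodalWeight_mul_dualHahnRatio {a α : ℝ} (ha : -1 / 2 < a)
    (h2 : α < 2 * a + 1) (l k : ℕ) :
    ∑ x ∈ Finset.Ico k (k + l + 1),
        Lagrange.nodalWeight (Finset.Ico k (k + l + 1)) (dualHahnGrid a) x *
          ((-1) ^ x * dualHahnRatio a α x) =
      (-1) ^ (k + l) * poch (α + 1) k / (poch (2 * a - α + 1) (k + l) * (l.factorial : ℝ)) := by
  induction l generalizing k with
  | zero => simp [Lagrange.nodalWeight, dualHahnRatio, mul_div_assoc]
  | succ l ih =>
    have ht := dualHahnGrid_strictMono ha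
    have hlt : k < k + (l + 1) := by omega
    have hne : dualHahnGrid a (k + (l + 1)) - dualHahnGrid a k ≠ 0 := (sub_pos.2 (ht hlt)).ne'
    have h := Lagrange.sub_mul_sum_nodalWeight_Ico ht.injective
      (fun x => (-1) ^ x * dualHahnRatio a α x) hlt
    have ih1 := ih (k + 1)
    rw [show k + 1 + l + 1 = k + (l + 1) + 1 by ring] at ih1
    have ih2 := ih k
    rw [show k + l + 1 = k + (l + 1) by ring] at ih2
    rw [ih1, ih2] at h
    refine mul_left_cancel₀ hne (h.trans ?_)
    rw [show k + 1 + l = k + l + 1 by ring, show k + (l + 1) = k + l + 1 by ring, poch_succ,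
      poch_succ, Nat.factorial_succ]
    have p1 : poch (2 * a - α + 1) (k + l) ≠ 0 := (poch_pos (by linarith) _).ne'
    have p2 : 2 * a - α + 1 + ((k + l : ℕ) : ℝ) ≠ 0 := by
      have : (0 : ℝ) ≤ ((k + l : ℕ) : ℝ) := Nat.cast_nonneg _
      exact (by linarith : 0 < 2 * a - α + 1 + ((k + l : ℕ) : ℝ)).ne'
    have p3 : (l.factorial : ℝ) ≠ 0 := by exact_mod_cast l.factorial_ne_zero
    simp only [dualHahnGrid]
    push_cast at p2 ⊢
    field_simp
    ring

open Polynomial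

/-- The dual Hahn polynomial as an element of `ℝ[X]`, written in the basis of monic nodal
polynomials of initial segments of the grid. -/
noncomputable def dualHahnPolynomial (a : ℝ) (M n : ℕ) (α : ℝ) : ℝ[X] :=
  ∑ k ∈ Finset.range (n + 1),
    C ((-1) ^ k * poch (-(n : ℝ)) k / (poch (α + 1) k * poch (-(M : ℝ)) k * (k.factorial : ℝ))) *
      ∏ j ∈ Finset.range k, (X - C (dualHahnGrid a j))

theorem eval_dualHahnPolynomial (a : ℝ) (M n : ℕ) (α x : ℝ) :
    (dualHahnPolynomial a M n α).eval x = dualHahnPoly a (M + 1) n α x := by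
  rw [dualHahnPolynomial, dualHahnPoly, eval_finsetSum]
  refine Finset.sum_congr rfl fun k _ => ?_
  have h : ∏ j ∈ Finset.range k, ((a + (j : ℝ)) * (a + (j : ℝ) + 1) - x) =
      (-1) ^ k * ∏ j ∈ Finset.range k, (x - dualHahnGrid a j) := by
    have h2 := Finset.prod_neg (s := Finset.range k) (fun j => x - dualHahnGrid a j)
    rw [Finset.card_range] at h2
    rw [← h2]
    exact Finset.prod_congr rfl fun j _ => by rw [dualHahnGrid]; ring
  rw [h, eval_mul, eval_C, eval_prod]
  simp only [eval_sub, eval_X, eval_C]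
  rw [show (1 : ℝ) - ((M + 1 : ℕ) : ℝ) = -(M : ℝ) by push_cast; ring]
  ring

theorem natDegree_dualHahnPolynomial {a α : ℝ} {M n : ℕ} (h1 : -1 < α) (hnM : n ≤ M) :
    (dualHahnPolynomial a M n α).natDegree = n := by
  have hmonic : ∀ k, (∏ j ∈ Finset.range k, (X - C (dualHahnGrid a j))).Monic := fun k =>
    monic_prod_of_monic _ _ fun j _ => monic_X_sub_C _
  have hdeg : ∀ k, (∏ j ∈ Finset.range k, (X - C (dualHahnGrid a j))).natDegree = k := fun k => by
    rw [natDegree_prod_of_monic _ _ fun j _ => monic_X_sub_C _]; simp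
  have hc : (-1) ^ n * poch (-(n : ℝ)) n /
      (poch (α + 1) n * poch (-(M : ℝ)) n * (n.factorial : ℝ)) ≠ 0 := by
    have p1 : poch (α + 1) n ≠ 0 := (poch_pos (by linarith) _).ne'
    have p2 : (n.descFactorial n : ℝ) ≠ 0 := by
      simpa [Nat.descFactorial_self] using n.factorial_ne_zero
    have p3 : (M.descFactorial n : ℝ) ≠ 0 := by
      exact_mod_cast (Nat.descFactorial_eq_zero_iff_lt.not.2 (by omega))
    have p4 : (n.factorial : ℝ) ≠ 0 := by exact_mod_cast n.factorial_ne_zero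
    rw [poch_neg_natCast, poch_neg_natCast]
    simp [p1, p2, p3, p4]
  refine natDegree_eq_of_le_of_coeff_ne_zero ?_ ?_
  · refine natDegree_sum_le_of_forall_le _ _ fun k hk => ?_
    refine (natDegree_C_mul_le _ _).trans ?_
    rw [hdeg]; simp at hk; omega
  · rw [dualHahnPolynomial, finsetSum_coeff, Finset.sum_eq_single n]
    · have := (hmonic n).coeff_natDegree
      rw [hdeg] at this
      rw [coeff_C_mul, this, mul_one]
      exact hc
    · intro k hk hkn
      rw [coeff_C_mul, coeff_eq_zero_of_natDegree_lt (by rw [hdeg]; simp at hk; omega), mul_zero]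
    · simp

/-- The positive weight of the dual Hahn polynomials on the grid points `0, …, M`. -/
noncomputable def dualHahnWeight (a : ℝ) (M : ℕ) (α : ℝ) (x : ℕ) : ℝ :=
  |Lagrange.nodalWeight (Finset.range (M + 1)) (dualHahnGrid a) x| * dualHahnRatio a α x

theorem dualHahnWeight_pos {a α : ℝ} (ha : -1 / 2 < a) (h1 : -1 < α) (h2 : α < 2 * a + 1)
    {M x : ℕ} (hx : x ∈ Finset.range (M + 1)) : 0 < dualHahnWeight a M α x :=
  mul_pos (abs_pos.2 (Lagrange.nodalWeight_ne_zero (dualHahnGrid_strictMono ha).injective.injOn hx))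
    (dualHahnRatio_pos h1 h2 x)

theorem sum_dualHahnWeight_mul {a : ℝ} (ha : -1 / 2 < a) (M : ℕ) (α : ℝ) (f : ℕ → ℝ) :
    ∑ x ∈ Finset.range (M + 1), dualHahnWeight a M α x * f x =
      (-1) ^ M * ∑ x ∈ Finset.range (M + 1),
        Lagrange.nodalWeight (Finset.range (M + 1)) (dualHahnGrid a) x *
          (f x * ((-1) ^ x * dualHahnRatio a α x)) := by
  rw [Finset.mul_sum]
  refine Finset.sum_congr rfl fun x hx => ?_
  rw [dualHahnWeight, Lagrange.abs_nodalWeight_range (dualHahnGrid_strictMono ha)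
    (Nat.lt_succ_iff.1 (Finset.mem_range.1 hx)), pow_add]
  ring

/-- Mixed moments of the dual Hahn weight against nodal polynomials of an initial and of a final
segment of the grid. -/
theorem sum_nodalWeight_mul_prod_mul_prod {a α : ℝ} (ha : -1 / 2 < a)
    (h2 : α < 2 * a + 1) {M m k : ℕ} (hm : m ≤ M) (hk : k ≤ M) :
    ∑ x ∈ Finset.range (M + 1),
        Lagrange.nodalWeight (Finset.range (M + 1)) (dualHahnGrid a) x *
          ((∏ j ∈ Finset.range k, (dualHahnGrid a x - dualHahnGrid a j)) *
            (∏ j ∈ Finset.Ico (M + 1 - m) (M + 1), (dualHahnGrid a x - dualHahnGrid a j)) *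
            ((-1) ^ x * dualHahnRatio a α x)) =
      (-1) ^ (M - m) * poch (α + 1) k * ((M - k).descFactorial m : ℝ) /
        (poch (2 * a - α + 1) (M - m) * ((M - k).factorial : ℝ)) := by
  rcases le_or_gt (k + m) M with h | h
  · have hsub : Finset.Ico k (M + 1 - m) ⊆ Finset.range (M + 1) := fun j => by simp; omega
    have hsd : Finset.range (M + 1) \ Finset.Ico k (M + 1 - m) =
        Finset.range k ∪ Finset.Ico (M + 1 - m) (M + 1) := by
      ext; simp; omega
    have hdisj : Disjoint (Finset.range k) (Finset.Ico (M + 1 - m) (M + 1)) := by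
      rw [Finset.disjoint_left]; intro j; simp; omega
    have h3 := Lagrange.sum_nodalWeight_mul_prod_sdiff
      (dualHahnGrid_strictMono ha).injective.injOn hsub (fun x => (-1) ^ x * dualHahnRatio a α x)
    rw [hsd] at h3
    simp only [Finset.prod_union hdisj] at h3
    rw [h3]
    have h4 := sum_nodalWeight_mul_dualHahnRatio ha h2 (M - k - m) k
    rw [show k + (M - k - m) + 1 = M + 1 - m by omega, show k + (M - k - m) = M - m by omega] at h4
    rw [h4]
    have h5 : ((M - k - m).factorial : ℝ) * ((M - k).descFactorial m : ℝ) =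
        ((M - k).factorial : ℝ) := by
      exact_mod_cast Nat.factorial_mul_descFactorial (by omega : m ≤ M - k)
    have p3 : ((M - k - m).factorial : ℝ) ≠ 0 := by exact_mod_cast Nat.factorial_ne_zero _
    have p4 : ((M - k).factorial : ℝ) ≠ 0 := by exact_mod_cast Nat.factorial_ne_zero _
    have p1 : poch (2 * a - α + 1) (M - m) ≠ 0 := (poch_pos (by linarith) _).ne'
    rw [div_eq_div_iff (mul_ne_zero p1 p3) (mul_ne_zero p1 p4), ← h5]
    ring
  · rw [Nat.descFactorial_of_lt (by omega)]
    simp only [Nat.cast_zero, mul_zero, zero_div]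
    refine Finset.sum_eq_zero fun x hx => ?_
    rcases lt_or_ge x k with hxk | hxk
    · rw [Finset.prod_eq_zero (Finset.mem_range.2 hxk) (sub_self _)]; simp
    · rw [Finset.prod_eq_zero (s := Finset.Ico (M + 1 - m) (M + 1)) (i := x) (by simp at hx ⊢; omega)
        (sub_self _)]
      simp

theorem isDiscreteOrthogonal_dualHahnPolynomial {a α : ℝ} (ha : -1 / 2 < a) (h1 : -1 < α)
    (h2 : α < 2 * a + 1) {M n : ℕ} (hnM : n ≤ M) :
    IsDiscreteOrthogonal (Finset.range (M + 1)) (dualHahnGrid a) (dualHahnWeight a M α)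
      (dualHahnPolynomial a M n α) := by
  intro q hq
  rw [natDegree_dualHahnPolynomial h1 hnM] at hq
  let L : ℝ[X] →ₗ[ℝ] ℝ :=
    { toFun := fun q => ∑ x ∈ Finset.range (M + 1), dualHahnWeight a M α x *
        ((dualHahnPolynomial a M n α).eval (dualHahnGrid a x) * q.eval (dualHahnGrid a x))
      map_add' := fun p q => by
        rw [← Finset.sum_add_distrib]
        exact Finset.sum_congr rfl fun x _ => by rw [eval_add]; ring
      map_smul' := fun c q => by
        rw [RingHom.id_apply, smul_eq_mul, Finset.mul_sum]
        exact Finset.sum_congr rfl fun x _ => by rw [eval_smul, smul_eq_mul]; ring }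
  let ψ : ℕ → ℝ[X] := fun m => ∏ j ∈ Finset.Ico (M + 1 - m) (M + 1 - m + m),
    (X - C (dualHahnGrid a j))
  refine L.eq_zero_of_natDegree_lt_of_monic (ψ := ψ)
    (fun m => monic_prod_of_monic _ _ fun j _ => monic_X_sub_C _)
    (fun m => by
      simp only [ψ]; rw [natDegree_prod_of_monic _ _ fun j _ => monic_X_sub_C _]; simp)
    (fun m hm => ?_) hq
  let p : ℝ[X] := (descPochhammer ℝ m).comp (C (M : ℝ) - X)
  have hp : p.natDegree < n := by
    refine natDegree_comp_le.trans_lt ?_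
    rw [descPochhammer_natDegree]
    have : (C (M : ℝ) - X).natDegree ≤ 1 := by
      rw [← neg_sub, natDegree_neg, natDegree_X_sub_C]
    nlinarith
  have key := sum_neg_one_pow_mul_choose_mul_eval hp
  change ∑ x ∈ Finset.range (M + 1), dualHahnWeight a M α x *
        ((dualHahnPolynomial a M n α).eval (dualHahnGrid a x) * (ψ m).eval (dualHahnGrid a x)) = 0
  have hψ : ∀ y, (ψ m).eval y = ∏ j ∈ Finset.Ico (M + 1 - m) (M + 1), (y - dualHahnGrid a j) :=
    fun y => by
      simp only [ψ]; rw [Nat.sub_add_cancel (by omega), eval_prod]; simp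
  rw [sum_dualHahnWeight_mul ha, mul_eq_zero]
  right
  simp only [hψ, dualHahnPolynomial, eval_finsetSum, eval_mul, eval_C, eval_prod, eval_sub, eval_X,
    Finset.sum_mul, Finset.mul_sum]
  rw [Finset.sum_comm]
  rw [← mul_zero ((-1) ^ (M - m) / (poch (2 * a - α + 1) (M - m) * (M.factorial : ℝ))), ← key,
    Finset.mul_sum]
  refine Finset.sum_congr rfl fun k hk => ?_
  have hkn : k ≤ n := Nat.lt_succ_iff.1 (Finset.mem_range.1 hk)
  have hmom := sum_nodalWeight_mul_prod_mul_prod ha h2 (m := m) (k := k) (M := M) (by omega)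
    (by omega)
  have hpe : p.eval (k : ℝ) = ((M - k).descFactorial m : ℝ) := by
    simp only [p, eval_comp, eval_sub, eval_C, eval_X]
    rw [← Nat.cast_sub (by omega), descPochhammer_eval_eq_descFactorial]
  have h5 : ((M - k).factorial : ℝ) * (M.descFactorial k : ℝ) = (M.factorial : ℝ) := by
    exact_mod_cast Nat.factorial_mul_descFactorial (by omega : k ≤ M)
  have p1 : poch (α + 1) k ≠ 0 := (poch_pos (by linarith) _).ne'
  have p2 : poch (2 * a - α + 1) (M - m) ≠ 0 := (poch_pos (by linarith) _).ne'
  have p3 : (M.descFactorial k : ℝ) ≠ 0 := by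
    exact_mod_cast (Nat.descFactorial_eq_zero_iff_lt.not.2 (by omega))
  have p4 : (k.factorial : ℝ) ≠ 0 := by exact_mod_cast k.factorial_ne_zero
  have p5 : ((M - k).factorial : ℝ) ≠ 0 := by exact_mod_cast Nat.factorial_ne_zero _
  rw [hpe, ← h5]
  trans ((-1) ^ k * poch (-(n : ℝ)) k /
      (poch (α + 1) k * poch (-(M : ℝ)) k * (k.factorial : ℝ))) *
      ((-1) ^ (M - m) * poch (α + 1) k * ((M - k).descFactorial m : ℝ) /
        (poch (2 * a - α + 1) (M - m) * ((M - k).factorial : ℝ)))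
  · rw [← hmom, Finset.mul_sum]
    exact Finset.sum_congr rfl fun x _ => by ring
  · rw [poch_neg_natCast, poch_neg_natCast, Nat.descFactorial_eq_factorial_mul_choose n k]
    push_cast
    field_simp

/-- zeros of dual Hahn polynomials: location and monotonicity in `α`. -/
theorem stmt_7 (a : ℝ) (ha : -1 / 2 < a) (N n : ℕ) (hN : 2 ≤ N) (hn : 1 ≤ n)
    (hnN : n ≤ N - 1) :
    ∃ X : ℝ → Fin n → ℝ,
      (∀ α : ℝ, -1 < α → α < 2 * a + 1 →
        StrictMono (X α) ∧
        (∀ j, X α j ∈ Set.Ioo (a * (a + 1)) ((a + (N : ℝ) - 1) * (a + (N : ℝ)))) ∧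
        (∀ j, dualHahnPoly a N n α (X α j) = 0) ∧
        (∀ y : ℝ, dualHahnPoly a N n α y = 0 → ∃ j, y = X α j)) ∧
      (0 ≤ a → ∀ j, StrictMonoOn (fun α => X α j) (Set.Ioo (-1) (2 * a + 1))) ∧
      (a < 0 → ∀ j, StrictMonoOn (fun α => X α j) (Set.Ioo a (2 * a + 1))) := by
  obtain ⟨M, rfl⟩ : ∃ M, N = M + 1 := ⟨N - 1, by omega⟩
  have hnM : n ≤ M := by omega
  have ht := dualHahnGrid_strictMono ha
  have hex : ∀ α : ℝ, ∃ x : Fin n → ℝ, -1 < α → α < 2 * a + 1 →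
      StrictMono x ∧ (∀ j, (dualHahnPolynomial a M n α).IsRoot (x j)) ∧
        (∀ y, (dualHahnPolynomial a M n α).IsRoot y → ∃ j, y = x j) ∧
        ∀ j, dualHahnGrid a 0 < x j ∧ x j < dualHahnGrid a M := by
    intro α
    by_cases h : -1 < α ∧ α < 2 * a + 1
    · obtain ⟨h1, h2⟩ := h
      have hP := isDiscreteOrthogonal_dualHahnPolynomial ha h1 h2 hnM
      have hd := natDegree_dualHahnPolynomial (a := a) h1 hnM
      have h0 : dualHahnPolynomial a M n α ≠ 0 := by intro h; rw [h] at hd; simp at hd; omega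
      have hs : (dualHahnPolynomial a M n α).natDegree < (Finset.range (M + 1)).card := by
        rw [hd, Finset.card_range]; omega
      have hw : ∀ i ∈ Finset.range (M + 1), 0 < dualHahnWeight a M α i :=
        fun i hi => dualHahnWeight_pos ha h1 h2 hi
      obtain ⟨x, hx1, hx2, hx3⟩ := hP.exists_roots ht.injective.injOn hw hs h0 hd
      refine ⟨x, fun _ _ => ⟨hx1, hx2, hx3, fun j => ⟨?_, ?_⟩⟩⟩
      · exact hP.lt_root ht.injective.injOn hw hs h0 (hx2 j) fun i _ hi => ht (by omega)
      · exact hP.root_lt ht.injective.injOn hw hs h0 (hx2 j) fun i hi hne =>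
          ht (by simp at hi; omega)
    · exact ⟨0, fun h1 h2 => absurd ⟨h1, h2⟩ h⟩
  choose x hx using hex
  have hmono : ∀ j, StrictMonoOn (fun α => x α j) (Set.Ioo (-1) (2 * a + 1)) := by
    intro j α hα β hβ hαβ
    obtain ⟨hx1, hx2, -, -⟩ := hx α hα.1 hα.2
    obtain ⟨hy1, hy2, -, -⟩ := hx β hβ.1 hβ.2
    have hP := isDiscreteOrthogonal_dualHahnPolynomial ha hα.1 hα.2 hnM
    have hQ := isDiscreteOrthogonal_dualHahnPolynomial ha hβ.1 hβ.2 hnM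
    have hw : dualHahnWeight a M β = fun i =>
        dualHahnRatio a β i / dualHahnRatio a α i * dualHahnWeight a M α i := by
      funext i
      have := (dualHahnRatio_pos hα.1 hα.2 i).ne'
      simp only [dualHahnWeight]
      field_simp
    rw [hw] at hQ
    exact hP.root_lt_root ht (dualHahnRatio_div_strictMono hα.1 hαβ hβ.2)
      (fun i hi => dualHahnWeight_pos ha hα.1 hα.2 hi)
      (fun i => div_pos (dualHahnRatio_pos hβ.1 hβ.2 i) (dualHahnRatio_pos hα.1 hα.2 i)) hQ hnM
      (natDegree_dualHahnPolynomial hα.1 hnM) (natDegree_dualHahnPolynomial hβ.1 hnM) hx1 hy1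
      hx2 hy2 j
  refine ⟨x, fun α h1 h2 => ?_, fun _ => hmono, fun _ j => (hmono j).mono ?_⟩
  · obtain ⟨hx1, hx2, hx3, hx4⟩ := hx α h1 h2
    simp only [IsRoot.def, eval_dualHahnPolynomial] at hx2 hx3
    refine ⟨hx1, fun j => ?_, hx2, hx3⟩
    obtain ⟨hl, hr⟩ := hx4 j
    simp only [dualHahnGrid, Nat.cast_zero, add_zero] at hl hr
    push_cast
    exact ⟨hl, by linear_combination hr⟩
  · exact Set.Ioo_subset_Ioo_left (by linarith)
end

section
/- Fix 0 < q < 1 and an integer n ≥ 1. For α > 0 and 0 ≤ β < q^{-1}, the q-Meixner polynomial M_n^{(α,β)}(·;q) has n distinct real zeros x_1(α,β) < ⋯ < x_n(α,β), and for each j ∈ {1,...,n} the zero x_j(α,β) is a strictly increasing function of α on (0, ∞) and a strictly decreasing function of β on [0, q^{-1}). -/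
/-- q-Pochhammer symbol `(a;q)_k = ∏_{j=0}^{k-1} (1 - a q^j)`. -/
noncomputable def qpoch (q a : ℝ) (k : ℕ) : ℝ := ∏ j ∈ Finset.range k, (1 - a * q ^ j)

/-- q-Meixner polynomial `M_n^{(α,β)}(x;q)`. -/
noncomputable def qMeixnerPoly (q : ℝ) (n : ℕ) (α β x : ℝ) : ℝ :=
  ∑ k ∈ Finset.range (n + 1),
    qpoch q (q ^ (-(n : ℤ))) k * qpoch q x k / (qpoch q (β * q) k * qpoch q q k) *
      (-(q ^ (n + 1)) / α) ^ k

/-- Coefficient of `qpoch q x k` in the q-Meixner polynomial. -/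
noncomputable def qMeixnerCoeff (q : ℝ) (n : ℕ) (α β : ℝ) (k : ℕ) : ℝ :=
  qpoch q (q ^ (-(n : ℤ))) k / (qpoch q (β * q) k * qpoch q q k) * (-(q ^ (n + 1)) / α) ^ k

theorem qMeixnerPoly_eq_sum (q : ℝ) (n : ℕ) (α β x : ℝ) :
    qMeixnerPoly q n α β x =
      ∑ k ∈ Finset.range (n + 1), qMeixnerCoeff q n α β k * qpoch q x k := by
  unfold qMeixnerPoly qMeixnerCoeff
  refine Finset.sum_congr rfl fun k _ => ?_
  ring

theorem qpoch_zero (q a : ℝ) : qpoch q a 0 = 1 := by simp [qpoch]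

theorem qpoch_succ (q a : ℝ) (k : ℕ) :
    qpoch q a (k + 1) = qpoch q a k * (1 - a * q ^ k) := by
  simp [qpoch, Finset.prod_range_succ]

theorem qpoch_succ' (q a : ℝ) (k : ℕ) :
    qpoch q a (k + 1) = (1 - a) * qpoch q (a * q) k := by
  simp only [qpoch, Finset.prod_range_succ', pow_zero, mul_one]
  rw [mul_comm]
  congr 1
  refine Finset.prod_congr rfl fun j _ => ?_
  ring

theorem qpoch_pos {q a : ℝ} (hq0 : 0 < q) (hq1 : q < 1) (ha0 : 0 ≤ a) (ha : a < 1) (k : ℕ) :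
    0 < qpoch q a k := by
  refine Finset.prod_pos fun j _ => ?_
  have := mul_le_of_le_one_right ha0 (pow_le_one₀ hq0.le hq1.le : q ^ j ≤ 1)
  linarith

theorem one_sub_mul_pow_pos {q a : ℝ} (hq0 : 0 < q) (hq1 : q < 1) (ha0 : 0 ≤ a) (ha : a < 1)
    (k : ℕ) : 0 < 1 - a * q ^ k := by
  have := mul_le_of_le_one_right ha0 (pow_le_one₀ hq0.le hq1.le : q ^ k ≤ 1)
  linarith

theorem qpoch_zpow_neg_eq_zero {q : ℝ} (hq0 : 0 < q) (n : ℕ) :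
    qpoch q (q ^ (-(n : ℤ))) (n + 1) = 0 := by
  rw [qpoch_succ]
  have : q ^ (-(n : ℤ)) * q ^ n = 1 := by
    rw [zpow_neg, zpow_natCast, inv_mul_cancel₀ (by positivity)]
  rw [this]; simp

theorem qMeixnerCoeff_zero (q : ℝ) (n : ℕ) (α β : ℝ) : qMeixnerCoeff q n α β 0 = 1 := by
  simp [qMeixnerCoeff, qpoch_zero]

theorem qMeixnerCoeff_eq_zero {q : ℝ} (hq0 : 0 < q) (n : ℕ) (α β : ℝ) :
    qMeixnerCoeff q n α β (n + 1) = 0 := by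
  rw [qMeixnerCoeff, qpoch_zpow_neg_eq_zero hq0, zero_div, zero_mul]

section Relations

variable {q α β : ℝ} (hq0 : 0 < q) (hq1 : q < 1) (hα : 0 < α) (hβ0 : 0 ≤ β) (hβ : β * q < 1)

include hq0 hq1 hα hβ0 hβ

theorem qMeixnerCoeff_succ_mul (m k : ℕ) :
    qMeixnerCoeff q (m + 1) α β (k + 1) * (α * (1 - β * q) * (1 - q ^ (k + 1))) =
      q * (1 - q ^ (m + 1)) * qMeixnerCoeff q m (α / q) (β * q) k := by
  have h1 : q ^ (-((m + 1 : ℕ) : ℤ)) * q = q ^ (-(m : ℤ)) := by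
    rw [← zpow_add_one₀ hq0.ne']; push_cast; congr 1; ring
  have h2 : q ^ (-((m + 1 : ℕ) : ℤ)) = (q ^ (m + 1))⁻¹ := by rw [zpow_neg, zpow_natCast]
  have hB := (qpoch_pos hq0 hq1 (mul_nonneg (mul_nonneg hβ0 hq0.le) hq0.le)
    (by nlinarith : β * q * q < 1) k).ne'
  have hQ := (qpoch_pos hq0 hq1 hq0.le hq1 k).ne'
  have hk := (one_sub_mul_pow_pos hq0 hq1 hq0.le hq1 k).ne'
  have hb : 1 - β * q ≠ 0 := by linarith
  unfold qMeixnerCoeff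
  rw [qpoch_succ' q (q ^ (-((m + 1 : ℕ) : ℤ))), h1, h2, qpoch_succ' q (β * q), qpoch_succ q q,
    pow_succ (-(q ^ (m + 1 + 1)) / α), pow_succ' q k]
  have h3 : -(q ^ (m + 1)) / (α / q) = -(q ^ (m + 1 + 1)) / α := by
    field_simp; ring
  rw [h3]
  generalize (-(q ^ (m + 1 + 1)) / α) ^ k = P
  field_simp
  ring

theorem qMeixnerCoeff_shift_succ_mul (m k : ℕ) :
    qMeixnerCoeff q m (α / q) (β * q) (k + 1) *
        (α * (1 - β * q ^ (k + 2)) * (1 - q ^ (k + 1))) =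
      (q ^ (k + 2) - q ^ (m + 2)) * qMeixnerCoeff q m (α / q) (β * q) k := by
  have h2 : q ^ (-(m : ℤ)) = (q ^ m)⁻¹ := by rw [zpow_neg, zpow_natCast]
  have hB := (qpoch_pos hq0 hq1 (mul_nonneg (mul_nonneg hβ0 hq0.le) hq0.le)
    (by nlinarith : β * q * q < 1) k).ne'
  have hQ := (qpoch_pos hq0 hq1 hq0.le hq1 k).ne'
  have hk := (one_sub_mul_pow_pos hq0 hq1 hq0.le hq1 k).ne'
  have hb := (one_sub_mul_pow_pos hq0 hq1 (mul_nonneg (mul_nonneg hβ0 hq0.le) hq0.le)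
    (by nlinarith : β * q * q < 1) k).ne'
  unfold qMeixnerCoeff
  rw [qpoch_succ q (q ^ (-(m : ℤ))), qpoch_succ q (β * q * q), qpoch_succ q q,
    pow_succ (-(q ^ (m + 1)) / (α / q))]
  have e1 : 1 - β * q ^ (k + 2) = 1 - β * q * q * q ^ k := by ring
  have e2 : 1 - q ^ (k + 1) = 1 - q * q ^ k := by ring
  have e3 : (1 - q ^ (-(m : ℤ)) * q ^ k) * (-(q ^ (m + 1)) / (α / q)) * α =
      q ^ (k + 2) - q ^ (m + 2) := by
    rw [h2]; field_simp; ring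
  rw [e1, e2, ← e3]
  generalize (-(q ^ (m + 1)) / (α / q)) ^ k = P
  generalize (-(q ^ (m + 1)) / (α / q)) = P'
  generalize q ^ (-(m : ℤ)) = P''
  generalize 1 - β * q * q * q ^ k = U at hb ⊢
  generalize 1 - q * q ^ k = V at hk ⊢
  field_simp

theorem qMeixnerCoeff_contiguous (m k : ℕ) :
    q * qMeixnerCoeff q m (α / q) (β * q) k +
        α * (1 - β * q ^ (k + 2)) * qMeixnerCoeff q m (α / q) (β * q) (k + 1) =
      α * (1 - β * q) * qMeixnerCoeff q (m + 1) α β (k + 1) := by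
  have h1 := qMeixnerCoeff_succ_mul hq0 hq1 hα hβ0 hβ m k
  have h2 := qMeixnerCoeff_shift_succ_mul hq0 hq1 hα hβ0 hβ m k
  have hk : 1 - q ^ (k + 1) ≠ 0 := by
    have := (one_sub_mul_pow_pos hq0 hq1 hq0.le hq1 k).ne'
    rwa [← pow_succ'] at this
  apply mul_right_cancel₀ hk
  linear_combination h2 - h1

/-- Forward shift relation. -/
theorem qMeixnerPoly_forward_shift (m : ℕ) (x : ℝ) :
    α * (1 - β * q) * (qMeixnerPoly q (m + 1) α β (x / q) - qMeixnerPoly q (m + 1) α β x) =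
      -(1 - q ^ (m + 1)) * x * qMeixnerPoly q m (α / q) (β * q) x := by
  rw [qMeixnerPoly_eq_sum, qMeixnerPoly_eq_sum, qMeixnerPoly_eq_sum, ← Finset.sum_sub_distrib,
    Finset.sum_range_succ', Finset.mul_sum]
  simp only [qpoch_zero, sub_self, add_zero]
  rw [Finset.mul_sum]
  refine Finset.sum_congr rfl fun k _ => ?_
  have h1 := qMeixnerCoeff_succ_mul hq0 hq1 hα hβ0 hβ m k
  rw [qpoch_succ' q (x / q), qpoch_succ q x, div_mul_cancel₀ _ hq0.ne']
  have h3 : (1 - x / q) - (1 - x * q ^ k) = - x * (1 - q ^ (k + 1)) / q := by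
    field_simp; ring
  have h4 : q * (1 - q ^ (m + 1)) * qMeixnerCoeff q m (α / q) (β * q) k / q =
    (1 - q ^ (m + 1)) * qMeixnerCoeff q m (α / q) (β * q) k := by field_simp
  linear_combination α * (1 - β * q) * qMeixnerCoeff q (m + 1) α β (k + 1) * qpoch q x k * h3
    - x * qpoch q x k / q * h1 - x * qpoch q x k * h4

theorem sum_qMeixner_backward (m N : ℕ) (x : ℝ) :
    ∑ k ∈ Finset.range (N + 1), qpoch q x k *
      (α * (1 - β * q) * x * qMeixnerCoeff q (m + 1) α β k
        - α * (x - β * q) * qMeixnerCoeff q m (α / q) (β * q) k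
        - q * (x + β * α) * (1 - x * q ^ k) * qMeixnerCoeff q m (α / q) (β * q) k) =
      - q * qMeixnerCoeff q m (α / q) (β * q) N * x * qpoch q x (N + 1) := by
  induction N with
  | zero =>
    simp [qpoch_succ, qpoch_zero, qMeixnerCoeff_zero]; ring
  | succ N ih =>
    rw [Finset.sum_range_succ, ih, qpoch_succ q x (N + 1)]
    have h := qMeixnerCoeff_contiguous hq0 hq1 hα hβ0 hβ m N
    linear_combination (-x * qpoch q x (N + 1)) * h

/-- Backward shift relation. -/
theorem qMeixnerPoly_backward_shift (m : ℕ) (x : ℝ) :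
    α * (1 - β * q) * x * qMeixnerPoly q (m + 1) α β x =
      α * (x - β * q) * qMeixnerPoly q m (α / q) (β * q) x
        - q * (x - 1) * (x + β * α) * qMeixnerPoly q m (α / q) (β * q) (q * x) := by
  have h := sum_qMeixner_backward hq0 hq1 hα hβ0 hβ m (m + 1) x
  rw [qMeixnerCoeff_eq_zero hq0] at h
  have hp : ∀ y, qMeixnerPoly q m (α / q) (β * q) y = ∑ k ∈ Finset.range (m + 1 + 1),
      qMeixnerCoeff q m (α / q) (β * q) k * qpoch q y k := fun y => by
    rw [Finset.sum_range_succ, qMeixnerCoeff_eq_zero hq0, qMeixnerPoly_eq_sum]; ring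
  rw [hp, hp, qMeixnerPoly_eq_sum, Finset.mul_sum, Finset.mul_sum, Finset.mul_sum,
    ← sub_eq_zero, ← Finset.sum_sub_distrib, ← Finset.sum_sub_distrib]
  rw [mul_zero, zero_mul, zero_mul] at h
  rw [← h]
  refine Finset.sum_congr rfl fun k _ => ?_
  have h1 := qpoch_succ q x k
  rw [qpoch_succ', mul_comm x q] at h1
  linear_combination q * (x + β * α) * qMeixnerCoeff q m (α / q) (β * q) k * (-h1)

/-- The q-difference equation, evaluated at a zero. -/
theorem qMeixnerPoly_q_difference_of_zero (n : ℕ) (hn : 1 ≤ n) {x : ℝ}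
    (hx : qMeixnerPoly q n α β x = 0) :
    -(α * (x - β * q) * qMeixnerPoly q n α β (x / q)) =
      (x - 1) * (x + β * α) * qMeixnerPoly q n α β (q * x) := by
  obtain ⟨m, rfl⟩ : ∃ m, n = m + 1 := ⟨n - 1, by omega⟩
  have h1 := qMeixnerPoly_forward_shift hq0 hq1 hα hβ0 hβ m x
  have h2 := qMeixnerPoly_forward_shift hq0 hq1 hα hβ0 hβ m (q * x)
  have h3 := qMeixnerPoly_backward_shift hq0 hq1 hα hβ0 hβ m x
  rw [mul_div_cancel_left₀ _ hq0.ne', hx] at h2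
  rw [hx] at h1 h3
  have hc : α * (1 - β * q) ≠ 0 := mul_ne_zero hα.ne' (by linarith)
  apply mul_left_cancel₀ hc
  linear_combination (-(α * (x - β * q))) * h1 + (x - 1) * (x + β * α) * h2
    - (1 - q ^ (m + 1)) * x * h3

end Relations

theorem qMeixnerPoly_one (q : ℝ) (n : ℕ) (α β : ℝ) : qMeixnerPoly q n α β 1 = 1 := by
  rw [qMeixnerPoly_eq_sum, Finset.sum_range_succ', qMeixnerCoeff_zero, qpoch_zero]
  simp [qpoch_succ']

/-- The q-Meixner polynomial as a polynomial. -/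
theorem exists_polynomial_qMeixnerPoly (q : ℝ) (n : ℕ) (α β : ℝ) :
    ∃ P : Polynomial ℝ, P.natDegree ≤ n ∧ ∀ x, P.eval x = qMeixnerPoly q n α β x := by
  refine ⟨∑ k ∈ Finset.range (n + 1), Polynomial.C (qMeixnerCoeff q n α β k) *
    ∏ j ∈ Finset.range k, (1 - Polynomial.X * Polynomial.C (q ^ j)), ?_, fun x => ?_⟩
  · refine Polynomial.natDegree_sum_le_of_forall_le _ _ fun k hk => ?_
    refine (Polynomial.natDegree_C_mul_le _ _).trans ((Polynomial.natDegree_prod_le _ _).trans ?_)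
    refine (Finset.sum_le_card_nsmul _ _ 1 fun j _ => by compute_degree).trans ?_
    simp only [Finset.card_range, smul_eq_mul, mul_one]
    exact Nat.lt_succ_iff.1 (Finset.mem_range.1 hk)
  · rw [qMeixnerPoly_eq_sum, Polynomial.eval_finsetSum]
    refine Finset.sum_congr rfl fun k _ => ?_
    simp [Polynomial.eval_prod, qpoch]

theorem continuous_qMeixnerPoly (q : ℝ) (n : ℕ) (α β : ℝ) :
    Continuous (qMeixnerPoly q n α β) := by
  obtain ⟨P, -, hP⟩ := exists_polynomial_qMeixnerPoly q n α β
  rw [← funext hP]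
  exact P.continuous

/-- A q-Meixner polynomial with `n` distinct zeros factors completely. -/
theorem qMeixnerPoly_eq_prod_of_zeros (q : ℝ) (n : ℕ) (α β : ℝ) (x : Fin n → ℝ)
    (hinj : Function.Injective x) (hx1 : ∀ j, 1 < x j)
    (hx : ∀ j, qMeixnerPoly q n α β (x j) = 0) :
    ∃ K : ℝ, 0 < K ∧ ∀ t, qMeixnerPoly q n α β t = K * ∏ j, (x j - t) := by
  obtain ⟨P, hdeg, hP⟩ := exists_polynomial_qMeixnerPoly q n α β
  have hpos : 0 < ∏ j, (x j - 1) := Finset.prod_pos fun j _ => sub_pos.2 (hx1 j)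
  refine ⟨(∏ j, (x j - 1))⁻¹, inv_pos.2 hpos, fun t => ?_⟩
  have h1 : (1 : ℝ) ∉ Finset.univ.image x := by
    simp only [Finset.mem_image, Finset.mem_univ, true_and, not_exists]
    exact fun j hj => (hx1 j).ne' hj
  have hcard : (insert 1 (Finset.univ.image x)).card = n + 1 := by
    rw [Finset.card_insert_of_notMem h1, Finset.card_image_of_injective _ hinj]; simp
  have heq : P = Polynomial.C (∏ j, (x j - 1))⁻¹ *
      ∏ j, (Polynomial.C (x j) - Polynomial.X) := by
    refine Polynomial.eq_of_degrees_lt_of_eval_finset_eq (insert 1 (Finset.univ.image x))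
      ?_ ?_ ?_
    · rw [hcard]
      exact Polynomial.degree_le_natDegree.trans_lt (by exact_mod_cast Nat.lt_succ_of_le hdeg)
    · rw [hcard]
      refine Polynomial.degree_le_natDegree.trans_lt ?_
      have : (Polynomial.C (∏ j, (x j - 1))⁻¹ *
          ∏ j, (Polynomial.C (x j) - Polynomial.X)).natDegree ≤ n := by
        refine (Polynomial.natDegree_C_mul_le _ _).trans
          ((Polynomial.natDegree_prod_le _ _).trans ?_)
        refine (Finset.sum_le_card_nsmul _ _ 1 fun j _ => by compute_degree).trans ?_
        simp
      exact_mod_cast Nat.lt_succ_of_le this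
    · intro y hy
      rw [Finset.mem_insert, Finset.mem_image] at hy
      rw [hP]
      rcases hy with rfl | ⟨j, -, rfl⟩
      · simp [Polynomial.eval_prod, qMeixnerPoly_one, hpos.ne']
      · have h0 : ∏ i, (x i - x j) = 0 :=
          Finset.prod_eq_zero (Finset.mem_univ j) (sub_self _)
        simp [hx, Polynomial.eval_prod, h0]
  rw [← hP, heq]
  simp [Polynomial.eval_prod]

theorem ratio_le_ratio {q a b c d : ℝ} (hq0 : 0 < q) (hq1 : q < 1) (h : c * b ≤ d * a)
    (hden : 0 < (a - b / q) * (c - d / q)) :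
    (a - q * b) / (a - b / q) ≤ (c - q * d) / (c - d / q) := by
  have hne1 : a - b / q ≠ 0 := left_ne_zero_of_mul hden.ne'
  have hne2 : c - d / q ≠ 0 := right_ne_zero_of_mul hden.ne'
  have hq : 0 ≤ 1 / q - q := by
    rw [sub_nonneg, le_div_iff₀ hq0]; nlinarith
  have : (c - q * d) / (c - d / q) - (a - q * b) / (a - b / q) =
      (d * a - c * b) * (1 / q - q) / ((a - b / q) * (c - d / q)) := by
    rw [div_sub_div _ _ hne2 hne1, mul_comm (a - b / q)]
    congr 1
    field_simp
    ring
  rw [← sub_nonneg, this]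
  exact div_nonneg (mul_nonneg (sub_nonneg.2 h) hq) hden.le

/-- Comparison principle for two `q`-separated solutions of a system of Bethe type. -/
theorem lt_of_prod_ratio_eq {q : ℝ} (hq0 : 0 < q) (hq1 : q < 1) {n : ℕ} {x y : Fin n → ℝ}
    (hx1 : ∀ j, 1 < x j) (hy1 : ∀ j, 1 < y j)
    (hx : ∀ i j, i < j → x i < q * x j) (hy : ∀ i j, i < j → y i < q * y j)
    {g h : ℝ → ℝ} (hg : AntitoneOn g (Set.Ioi 1)) (hgh : ∀ t, 1 < t → g t < h t)
    (hxg : ∀ k, ∏ j ∈ Finset.univ.erase k, (x j - q * x k) / (x j - x k / q) = g (x k))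
    (hyh : ∀ k, ∏ j ∈ Finset.univ.erase k, (y j - q * y k) / (y j - y k / q) = h (y k))
    (j : Fin n) : x j < y j := by
  by_contra! hj
  have hx0 : ∀ j, 0 < x j := fun j => one_pos.trans (hx1 j)
  have hy0 : ∀ j, 0 < y j := fun j => one_pos.trans (hy1 j)
  have : Nonempty (Fin n) := ⟨j⟩
  obtain ⟨k, hk⟩ := Finite.exists_max fun i => x i / y i
  have hyx : y k ≤ x k := by
    have := ((one_le_div (hy0 j)).2 hj).trans (hk j)
    exact (one_le_div (hy0 k)).1 this
  have hneg : ∀ {z : Fin n → ℝ}, (∀ j, 0 < z j) → (∀ i j, i < j → z i < q * z j) →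
      ∀ i, i < k → z i - q * z k < 0 ∧ z i - z k / q < 0 := fun {z} hz0 hz i hi => by
    have h1 := hz i k hi
    have h2 : q * z k < z k / q := by
      rw [lt_div_iff₀ hq0]; nlinarith [hz0 k, mul_pos hq0 (hz0 k)]
    constructor <;> linarith
  have hpos : ∀ {z : Fin n → ℝ}, (∀ j, 0 < z j) → (∀ i j, i < j → z i < q * z j) →
      ∀ i, k < i → 0 < z i - q * z k ∧ 0 < z i - z k / q := fun {z} hz0 hz i hi => by
    have h1 := hz k i hi
    have h2 : z k / q < z i := by rw [div_lt_iff₀ hq0]; linarith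
    have h3 : q * z k < z k / q := by
      rw [lt_div_iff₀ hq0]; nlinarith [hz0 k, mul_pos hq0 (hz0 k)]
    constructor <;> linarith
  have hle : h (y k) ≤ g (x k) := by
    rw [← hxg, ← hyh]
    refine Finset.prod_le_prod (fun i hi => ?_) fun i hi => ?_
    · rcases lt_or_gt_of_ne (Finset.ne_of_mem_erase hi) with hi | hi
      · exact div_nonneg_of_nonpos (hneg hy0 hy i hi).1.le (hneg hy0 hy i hi).2.le
      · exact div_nonneg (hpos hy0 hy i hi).1.le (hpos hy0 hy i hi).2.le
    · refine ratio_le_ratio hq0 hq1 ((div_le_div_iff₀ (hy0 i) (hy0 k)).1 (hk i)) ?_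
      rcases lt_or_gt_of_ne (Finset.ne_of_mem_erase hi) with hi | hi
      · exact mul_pos_of_neg_of_neg (hneg hy0 hy i hi).2 (hneg hx0 hx i hi).2
      · exact mul_pos (hpos hy0 hy i hi).2 (hpos hx0 hx i hi).2
  exact ((hgh _ (hy1 k)).trans_le (hle.trans (hg (hy1 k) (hx1 k) hyx))).false

/-- The zeros of `qMeixnerPoly q n α β`: `n` points above `1` with consecutive ratios `> q⁻¹`. -/
structure IsQMeixnerZeros (q : ℝ) (n : ℕ) (α β : ℝ) (x : Fin n → ℝ) : Prop where
  one_lt : ∀ j, 1 < x j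
  lt_mul : ∀ i j, i < j → x i < q * x j
  eq_zero : ∀ j, qMeixnerPoly q n α β (x j) = 0

/-- Right-hand side of the equations satisfied by the zeros. -/
noncomputable def qMeixnerRatio (q α β t : ℝ) : ℝ :=
  α * (t - β * q) / (q * ((t - 1) * (t + β * α)))

section Ratio

variable {q : ℝ} (hq0 : 0 < q)

include hq0

theorem antitoneOn_qMeixnerRatio {α β : ℝ} (hα : 0 < α) (hβ0 : 0 ≤ β) (hβ : β * q < 1) :
    AntitoneOn (qMeixnerRatio q α β) (Set.Ioi 1) := by
  intro s hs t ht hst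
  rw [Set.mem_Ioi] at hs ht
  have hba := mul_nonneg hβ0 hα.le
  have h1 : (t - β * q) * (s - 1) * (s + β * α) ≤ (s - β * q) * (t - 1) * (t + β * α) := by
    refine mul_le_mul ?_ (by linarith) (by linarith) ?_
    · nlinarith
    · exact mul_nonneg (by linarith) (by linarith)
  unfold qMeixnerRatio
  rw [div_le_div_iff₀ (by have := mul_pos (sub_pos.2 ht) (by linarith : 0 < t + β * α); positivity)
    (by have := mul_pos (sub_pos.2 hs) (by linarith : 0 < s + β * α); positivity)]
  linarith [mul_le_mul_of_nonneg_left h1 (mul_pos hα hq0).le]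

theorem qMeixnerRatio_lt_of_lt_left {α α' β t : ℝ} (hα : 0 < α) (hαα' : α < α') (hβ0 : 0 ≤ β)
    (hβ : β * q < 1) (ht : 1 < t) : qMeixnerRatio q α β t < qMeixnerRatio q α' β t := by
  have hba := mul_nonneg hβ0 hα.le
  have hba' := mul_nonneg hβ0 (hα.trans hαα').le
  have h1 : 0 < t + β * α := by linarith
  have h2 : 0 < t + β * α' := by linarith
  have h3 : 0 < t - β * q := by linarith
  have h4 : 0 < t - 1 := by linarith
  unfold qMeixnerRatio
  rw [div_lt_div_iff₀ (by positivity) (by positivity)]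
  have : 0 < (t - β * q) * q * (t - 1) * ((α' - α) * t) := by
    have := sub_pos.2 hαα'
    positivity
  linarith

theorem qMeixnerRatio_lt_of_lt_right {α β β' t : ℝ} (hα : 0 < α) (hβ0 : 0 ≤ β) (hββ' : β < β')
    (ht : 1 < t) : qMeixnerRatio q α β' t < qMeixnerRatio q α β t := by
  have hba := mul_nonneg hβ0 hα.le
  have hba' := mul_nonneg (hβ0.trans hββ'.le) hα.le
  have h1 : 0 < t + β * α := by linarith
  have h2 : 0 < t + β' * α := by linarith
  have h4 : 0 < t - 1 := by linarith
  unfold qMeixnerRatio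
  rw [div_lt_div_iff₀ (by positivity) (by positivity)]
  have : 0 < α * q * (t - 1) * ((β' - β) * t * (α + q)) := by
    have := sub_pos.2 hββ'
    positivity
  linarith

end Ratio

namespace IsQMeixnerZeros

section

variable {q α β : ℝ} {n : ℕ} {x : Fin n → ℝ} (hx : IsQMeixnerZeros q n α β x) (hq1 : q < 1)

include hx hq1

theorem strictMono : StrictMono x := fun i j hij =>
  (hx.lt_mul i j hij).trans (mul_lt_of_lt_one_left (one_pos.trans (hx.one_lt j)) hq1)

theorem exists_eq_prod : ∃ K : ℝ, 0 < K ∧ ∀ t, qMeixnerPoly q n α β t = K * ∏ j, (x j - t) :=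
  qMeixnerPoly_eq_prod_of_zeros q n α β x (hx.strictMono hq1).injective hx.one_lt hx.eq_zero

theorem exists_eq_of_eq_zero {y : ℝ} (hy : qMeixnerPoly q n α β y = 0) : ∃ j, y = x j := by
  obtain ⟨K, hK, h⟩ := hx.exists_eq_prod hq1
  rw [h, mul_eq_zero, or_iff_right hK.ne', Finset.prod_eq_zero_iff] at hy
  obtain ⟨j, -, hj⟩ := hy
  exact ⟨j, (sub_eq_zero.1 hj).symm⟩

theorem prod_ratio_eq (hq0 : 0 < q) (hα : 0 < α) (hβ0 : 0 ≤ β) (hβ : β * q < 1) (k : Fin n) :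
    ∏ j ∈ Finset.univ.erase k, (x j - q * x k) / (x j - x k / q) =
      qMeixnerRatio q α β (x k) := by
  obtain ⟨K, hK, h⟩ := hx.exists_eq_prod hq1
  have hx1 := hx.one_lt k
  have heq := qMeixnerPoly_q_difference_of_zero hq0 hq1 hα hβ0 hβ n k.pos (hx.eq_zero k)
  rw [h, h, ← Finset.mul_prod_erase _ _ (Finset.mem_univ k),
    ← Finset.mul_prod_erase _ _ (Finset.mem_univ k)] at heq
  have hB : ∏ j ∈ Finset.univ.erase k, (x j - x k / q) ≠ 0 := by
    refine Finset.prod_ne_zero_iff.2 fun j hj => ?_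
    rw [sub_ne_zero, ne_eq, eq_div_iff hq0.ne']
    have hxj := hx.one_lt j
    rcases lt_or_gt_of_ne (Finset.ne_of_mem_erase hj) with hj | hj
    · have := hx.strictMono hq1 hj
      nlinarith
    · have := hx.lt_mul k j hj
      linarith
  have h1 : x k - 1 ≠ 0 := by linarith
  have h2 : x k + β * α ≠ 0 := by linarith [mul_nonneg hβ0 hα.le]
  rw [Finset.prod_div_distrib, qMeixnerRatio, div_eq_div_iff hB (by positivity)]
  generalize ∏ j ∈ Finset.univ.erase k, (x j - x k / q) = B at heq
  generalize ∏ j ∈ Finset.univ.erase k, (x j - q * x k) = A at heq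
  have hc : K * (1 - q) * x k ≠ 0 :=
    mul_ne_zero (mul_ne_zero hK.ne' (by linarith)) (by linarith)
  apply mul_left_cancel₀ hc
  have h3 : (x k - x k / q) * q = - ((1 - q) * x k) := by field_simp; ring
  linear_combination (-q) * heq - K * B * α * (x k - β * q) * h3

end

theorem lt_of_ratio_lt {q α β α' β' : ℝ} {n : ℕ} {x y : Fin n → ℝ}
    (hx : IsQMeixnerZeros q n α β x) (hy : IsQMeixnerZeros q n α' β' y)
    (hq0 : 0 < q) (hq1 : q < 1) (hα : 0 < α) (hβ0 : 0 ≤ β) (hβ : β * q < 1)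
    (hα' : 0 < α') (hβ0' : 0 ≤ β') (hβ' : β' * q < 1)
    (hlt : ∀ t, 1 < t → qMeixnerRatio q α β t < qMeixnerRatio q α' β' t) (j : Fin n) :
    x j < y j :=
  lt_of_prod_ratio_eq hq0 hq1 hx.one_lt hy.one_lt hx.lt_mul hy.lt_mul
    (antitoneOn_qMeixnerRatio hq0 hα hβ0 hβ) hlt
    (hx.prod_ratio_eq hq1 hq0 hα hβ0 hβ) (hy.prod_ratio_eq hq1 hq0 hα' hβ0' hβ') j

end IsQMeixnerZeros

theorem exists_Ioo_eq_zero_of_mul_neg {f : ℝ → ℝ} (hf : Continuous f) {a b : ℝ} (hab : a ≤ b)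
    (h : f a * f b < 0) : ∃ t ∈ Set.Ioo a b, f t = 0 := by
  rcases mul_neg_iff.1 h with ⟨ha, hb⟩ | ⟨ha, hb⟩
  · exact intermediate_value_Ioo' hab hf.continuousOn ⟨hb, ha⟩
  · exact intermediate_value_Ioo hab hf.continuousOn ⟨ha, hb⟩

/-- A point beyond which the second term of the backward shift relation dominates. -/
theorem exists_gt_backward_shift_neg {q α β : ℝ} (hq0 : 0 < q) (hq1 : q < 1) (hα : 0 < α)
    (hβ0 : 0 ≤ β) (hβ : β * q < 1) {m : ℕ} (z : Fin m → ℝ) (hz : ∀ j, 0 < z j) (L : ℝ) :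
    ∃ R, L < R ∧ (∀ j, z j < q * R) ∧
      (α * (R - β * q) * ∏ j, (z j - R) - q * (R - 1) * (R + β * α) * ∏ j, (z j - q * R)) *
        ∏ j, (z j - q * R) < 0 := by
  obtain ⟨B, hB⟩ := (Set.finite_range z).bddAbove
  have hzB : ∀ j, z j ≤ B := fun j => hB (Set.mem_range_self j)
  obtain ⟨R, hR⟩ := exists_gt (max (max L (2 * B / q)) (1 + α * (2 / q) ^ m / q))
  rw [max_lt_iff, max_lt_iff, div_lt_iff₀ hq0] at hR
  obtain ⟨⟨hL, hRB⟩, hR1⟩ := hR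
  have hpos : 0 < α * (2 / q) ^ m / q := by positivity
  have hR0 : 1 < R := by linarith
  have hzR : ∀ j, 0 < q * R - z j := fun j => by linarith [hzB j, hz j]
  refine ⟨R, hL, fun j => sub_pos.1 (hzR j), ?_⟩
  set P := ∏ j, (z j - R)
  set Q := ∏ j, (z j - q * R)
  have hQ : Q ≠ 0 := Finset.prod_ne_zero_iff.2 fun j _ => by linarith [hzR j]
  have hPQ : |P| ≤ (2 / q) ^ m * |Q| := by
    have hcard : (2 / q) ^ m = ∏ _j : Fin m, (2 / q) := by
      rw [Finset.prod_const, Finset.card_univ, Fintype.card_fin]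
    rw [hcard, Finset.abs_prod, Finset.abs_prod, ← Finset.prod_mul_distrib]
    refine Finset.prod_le_prod (fun j _ => abs_nonneg _) fun j _ => ?_
    rw [abs_sub_comm (z j) (q * R), abs_of_pos (hzR j), div_mul_eq_mul_div, le_div_iff₀ hq0]
    have h1 : |z j - R| * q = |q * z j - q * R| := by
      rw [← mul_sub, abs_mul, abs_of_pos hq0, mul_comm]
    rw [h1, abs_le]
    have h2 := hzB j
    have h3 := mul_pos hq0 (hz j)
    have h4 := mul_lt_of_lt_one_left (hz j) hq1
    constructor <;> linarith
  have hba := mul_nonneg hβ0 hα.le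
  have hQQ : 0 < Q ^ 2 := by positivity
  have h1 : α * (2 / q) ^ m < q * (R - 1) := by
    rw [← lt_sub_iff_add_lt', div_lt_iff₀ hq0] at hR1; linarith
  have hPQ' : P * Q ≤ (2 / q) ^ m * Q ^ 2 := by
    calc P * Q ≤ |P| * |Q| := by rw [← abs_mul]; exact le_abs_self _
      _ ≤ (2 / q) ^ m * |Q| * |Q| := by gcongr
      _ = (2 / q) ^ m * Q ^ 2 := by rw [mul_assoc, abs_mul_abs_self, sq]
  have h2 : α * (R - β * q) * (P * Q) ≤ α * (R - β * q) * ((2 / q) ^ m * Q ^ 2) :=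
    mul_le_mul_of_nonneg_left hPQ' (mul_nonneg hα.le (by linarith))
  have h3 : (R - β * q) * (α * (2 / q) ^ m * Q ^ 2) ≤ (R + β * α) * (α * (2 / q) ^ m * Q ^ 2) :=
    mul_le_mul_of_nonneg_right (by linarith [mul_nonneg hβ0 hq0.le]) (by positivity)
  have h4 : (R + β * α) * Q ^ 2 * (α * (2 / q) ^ m) < (R + β * α) * Q ^ 2 * (q * (R - 1)) :=
    mul_lt_mul_of_pos_left h1 (mul_pos (by linarith) hQQ)
  linarith

theorem IsQMeixnerZeros.exists_zero_succ {q α β : ℝ} (hq0 : 0 < q) (hq1 : q < 1) (hα : 0 < α)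
    (hβ0 : 0 ≤ β) (hβ : β * q < 1) {m : ℕ} {z : Fin m → ℝ}
    (hz : IsQMeixnerZeros q m (α / q) (β * q) z) (i : Fin (m + 1)) :
    ∃ t, qMeixnerPoly q (m + 1) α β t = 0 ∧ 1 < t ∧
      (∀ j : Fin m, j.castSucc < i → z j < q * t) ∧ (∀ j : Fin m, i ≤ j.castSucc → t < z j) := by
  obtain ⟨K, hK, hp⟩ := hz.exists_eq_prod hq1
  have hM : ∀ t, α * (1 - β * q) * t * qMeixnerPoly q (m + 1) α β t =
      K * (α * (t - β * q) * ∏ j, (z j - t)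
        - q * (t - 1) * (t + β * α) * ∏ j, (z j - q * t)) := fun t => by
    rw [qMeixnerPoly_backward_shift hq0 hq1 hα hβ0 hβ, hp, hp]; ring
  have hba := mul_nonneg hβ0 hα.le
  have hz0 : ∀ j, 0 < z j := fun j => one_pos.trans (hz.one_lt j)
  have hzm := hz.strictMono hq1
  have hl : ∃ l, 1 ≤ l ∧ (∀ j : Fin m, j.castSucc < i → z j ≤ q * l) ∧
      (∀ j : Fin m, i ≤ j.castSucc → l < z j) ∧
      q * (l - 1) * (l + β * α) * ∏ j, (z j - q * l) = 0 := by
    induction i using Fin.cases with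
    | zero => exact ⟨1, le_rfl, fun j hj => absurd hj (Fin.not_lt_zero _),
        fun j _ => hz.one_lt j, by simp⟩
    | succ i =>
      have hi : q * (z i / q) = z i := mul_div_cancel₀ _ hq0.ne'
      refine ⟨z i / q, ?_, fun j hj => ?_, fun j hj => ?_, ?_⟩
      · rw [one_le_div hq0]
        exact (hq1.trans (hz.one_lt i)).le
      · rw [hi]
        exact hzm.monotone (Fin.castSucc_lt_succ_iff.1 hj)
      · rw [div_lt_iff₀' hq0]
        exact hz.lt_mul i j (Fin.succ_le_castSucc_iff.1 hj)
      · rw [Finset.prod_eq_zero (Finset.mem_univ i) (by rw [hi, sub_self]), mul_zero]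
  obtain ⟨l, hl1, hlj, hlz, hl0⟩ := hl
  have hr : ∃ r, l < r ∧ (∀ j : Fin m, j.castSucc < i → z j < q * r) ∧
      (∀ j : Fin m, i ≤ j.castSucc → q * r < z j ∧ r ≤ z j) ∧
      (α * (r - β * q) * ∏ j, (z j - r) - q * (r - 1) * (r + β * α) * ∏ j, (z j - q * r)) *
        ∏ j, (z j - q * r) < 0 := by
    induction i using Fin.lastCases with
    | last =>
      obtain ⟨R, hlR, hzR, hR⟩ := exists_gt_backward_shift_neg hq0 hq1 hα hβ0 hβ z hz0 l
      exact ⟨R, hlR, fun j _ => hzR j,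
        fun j hj => absurd (Fin.castSucc_lt_last j) hj.not_gt, hR⟩
    | cast i =>
      have hlt : ∀ j, i ≤ j → q * z i < z j := fun j hj =>
        (mul_lt_of_lt_one_left (hz0 i) hq1).trans_le (hzm.monotone hj)
      refine ⟨z i, hlz i le_rfl, fun j hj => hz.lt_mul j i (Fin.castSucc_lt_castSucc_iff.1 hj),
        fun j hj => ⟨hlt j (Fin.castSucc_le_castSucc_iff.1 hj),
          hzm.monotone (Fin.castSucc_le_castSucc_iff.1 hj)⟩, ?_⟩
      rw [Finset.prod_eq_zero (Finset.mem_univ i) (sub_self (z i)), mul_zero, zero_sub, neg_mul,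
        neg_neg_iff_pos, mul_assoc]
      have hQ : ∏ j, (z j - q * z i) ≠ 0 := by
        refine Finset.prod_ne_zero_iff.2 fun j _ => ?_
        rcases lt_or_ge j i with hj | hj
        · exact (sub_neg.2 (hz.lt_mul j i hj)).ne
        · exact (sub_pos.2 (hlt j hj)).ne'
      have h1 := sub_pos.2 (hz.one_lt i)
      have h2 : 0 < z i + β * α := by linarith [hz0 i]
      have h3 := mul_self_pos.2 hQ
      positivity
  obtain ⟨r, hlr, hrj, hrz, hr0⟩ := hr
  have hprod : 0 < (∏ j, (z j - l)) * ∏ j, (z j - q * r) := by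
    rw [← Finset.prod_mul_distrib]
    refine Finset.prod_pos fun j _ => ?_
    rcases lt_or_ge j.castSucc i with hj | hj
    · refine mul_pos_of_neg_of_neg ?_ (sub_neg.2 (hrj j hj))
      have h1 := hlj j hj
      have h2 := mul_lt_of_lt_one_left (by linarith : 0 < l) hq1
      linarith
    · exact mul_pos (sub_pos.2 (hlz j hj)) (sub_pos.2 (hrz j hj).1)
  have hc : 0 < α * (1 - β * q) := mul_pos hα (by linarith)
  have hl2 := hM l
  have hr2 := hM r
  rw [hl0, sub_zero] at hl2
  generalize ∏ j, (z j - q * r) = Q at *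
  have hlpos : 0 < qMeixnerPoly q (m + 1) α β l * Q := by
    have h1 : 0 < α * (1 - β * q) * l := mul_pos hc (by linarith)
    refine pos_of_mul_pos_right ?_ h1.le
    have h2 : 0 < K * (α * (l - β * q)) := mul_pos hK (mul_pos hα (by linarith))
    have := mul_pos h2 hprod
    rw [← mul_assoc, hl2]
    linarith
  have hrneg : qMeixnerPoly q (m + 1) α β r * Q < 0 := by
    have h1 : 0 < α * (1 - β * q) * r := mul_pos hc (by linarith)
    refine neg_of_mul_neg_right ?_ h1.le
    have := mul_neg_of_pos_of_neg hK hr0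
    rw [← mul_assoc, hr2]
    linarith
  have hneg : qMeixnerPoly q (m + 1) α β l * qMeixnerPoly q (m + 1) α β r < 0 := by
    refine neg_of_mul_neg_left ?_ (mul_self_nonneg Q)
    linarith [mul_neg_of_pos_of_neg hlpos hrneg]
  obtain ⟨t, ⟨hlt, htr⟩, ht⟩ :=
    exists_Ioo_eq_zero_of_mul_neg (continuous_qMeixnerPoly q (m + 1) α β) hlr.le hneg
  exact ⟨t, ht, hl1.trans_lt hlt,
    fun j hj => (hlj j hj).trans_lt (mul_lt_mul_of_pos_left hlt hq0),
    fun j hj => htr.trans_le (hrz j hj).2⟩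

theorem exists_isQMeixnerZeros {q : ℝ} (hq0 : 0 < q) (hq1 : q < 1) (n : ℕ) :
    ∀ {α β : ℝ}, 0 < α → 0 ≤ β → β * q < 1 → ∃ x : Fin n → ℝ, IsQMeixnerZeros q n α β x := by
  induction n with
  | zero => exact fun _ _ _ => ⟨Fin.elim0, fun j => j.elim0, fun j => j.elim0, fun j => j.elim0⟩
  | succ m ih =>
    intro α β hα hβ0 hβ
    obtain ⟨z, hz⟩ := ih (div_pos hα hq0) (mul_nonneg hβ0 hq0.le)
      (by nlinarith : β * q * q < 1)
    choose x hx0 hx1 hxl hxr using hz.exists_zero_succ hq0 hq1 hα hβ0 hβ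
    refine ⟨x, hx1, fun i j hij => ?_, hx0⟩
    obtain ⟨i, rfl⟩ := Fin.exists_castSucc_eq.2 (Fin.ne_last_of_lt hij)
    exact (hxr _ i le_rfl).trans (hxl j i hij)

/-- zeros of q-Meixner polynomials: monotonicity in `α` and `β`. -/
theorem stmt_8 (q : ℝ) (hq0 : 0 < q) (hq1 : q < 1) (n : ℕ) (hn : 1 ≤ n) :
    ∃ x : ℝ → ℝ → Fin n → ℝ,
      (∀ α β : ℝ, 0 < α → 0 ≤ β → β < q⁻¹ →
        StrictMono (x α β) ∧
        (∀ j, qMeixnerPoly q n α β (x α β j) = 0) ∧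
        (∀ y : ℝ, qMeixnerPoly q n α β y = 0 → ∃ j, y = x α β j)) ∧
      (∀ β : ℝ, 0 ≤ β → β < q⁻¹ →
        ∀ j, StrictMonoOn (fun α => x α β j) (Set.Ioi 0)) ∧
      (∀ α : ℝ, 0 < α →
        ∀ j, StrictAntiOn (fun β => x α β j) (Set.Ico 0 q⁻¹)) := by
  have hβq : ∀ {β : ℝ}, β < q⁻¹ → β * q < 1 := fun h => by
    rwa [← one_div, lt_div_iff₀ hq0] at h
  have hex : ∀ α β : ℝ, ∃ x : Fin n → ℝ,
      0 < α → 0 ≤ β → β < q⁻¹ → IsQMeixnerZeros q n α β x := fun α β => by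
    by_cases h : 0 < α ∧ 0 ≤ β ∧ β < q⁻¹
    · obtain ⟨x, hx⟩ := exists_isQMeixnerZeros hq0 hq1 n h.1 h.2.1 (hβq h.2.2)
      exact ⟨x, fun _ _ _ => hx⟩
    · exact ⟨0, fun h1 h2 h3 => absurd ⟨h1, h2, h3⟩ h⟩
  choose x hx using hex
  refine ⟨x, fun α β hα hβ0 hβ => ?_, fun β hβ0 hβ j α hα α' hα' hlt => ?_,
    fun α hα j β hβ β' hβ' hlt => ?_⟩
  · have h := hx α β hα hβ0 hβ
    exact ⟨h.strictMono hq1, h.eq_zero, fun y hy => h.exists_eq_of_eq_zero hq1 hy⟩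
  · rw [Set.mem_Ioi] at hα hα'
    exact (hx α β hα hβ0 hβ).lt_of_ratio_lt (hx α' β hα' hβ0 hβ) hq0 hq1 hα hβ0 (hβq hβ)
      hα' hβ0 (hβq hβ) (fun t ht => qMeixnerRatio_lt_of_lt_left hq0 hα hlt hβ0 (hβq hβ) ht) j
  · exact (hx α β' hα hβ'.1 hβ'.2).lt_of_ratio_lt (hx α β hα hβ.1 hβ.2) hq0 hq1
      hα hβ'.1 (hβq hβ'.2) hα hβ.1 (hβq hβ.2)
      (fun t ht => qMeixnerRatio_lt_of_lt_right hq0 hα hβ.1 hlt ht) j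
end
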